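/- arXiv:math/0304002 — 5 statements merged into one kernel-verified Lean document; each statement's English description precedes it below -/
import Mathlib

section
/- Let φ be a continuous nonvanishing function on the unit circle lying in the Wiener algebra which is even, i.e. φ̂(k) = φ̂(−k) for all k ∈ ℤ, and let ψ = 1/φ, which also lies in the Wiener algebra. Then for all j, k ∈ ℤ≥0 one has ∑_{l=0}^{∞} (φ̂(j−l) + φ̂(j+l+1)) · (ψ̂(l−k) + ψ̂(l+k+1)) = δ_{jk} (equal to 1 if j = k and 0 otherwise); the series converges absolutely. (This is the entrywise form of the operator identity (T(φ)+H(φ))(T(φ⁻¹)+H(φ⁻¹)) = I on ℓ²(ℤ≥0), where T(φ) = (φ̂(j−k))_{j,k≥0} and H(φ) = (φ̂(j+k+1))_{j,k≥0}.) -/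
open Complex Real

/-- Wiener's lemma for a bounded representation of `ℤ` in a commutative Banach algebra: an
absolutely convergent Fourier series without zeros is sent to a unit. -/
theorem isUnit_tsum_smul_of_commRing {A : Type*} [NormedCommRing A] [NormedAlgebra ℂ A]
    [CompleteSpace A] (U : Multiplicative ℤ →* A) {C : ℝ} (hU : ∀ n, ‖U n‖ ≤ C)
    {a : ℤ → ℂ} (ha : Summable fun k => ‖a k‖)
    (h : ∀ θ : ℝ, ∑' k : ℤ, a k * Complex.exp (Complex.I * k * θ) ≠ 0) :
    IsUnit (∑' k : ℤ, a k • U (.ofAdd k)) := by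
  by_contra hu
  obtain ⟨χ, hχ⟩ := WeakDual.CharacterSpace.exists_apply_eq_zero hu
  have hsum : Summable fun k : ℤ => a k • U (.ofAdd k) := by
    refine .of_norm_bounded (ha.mul_right C) fun k => ?_
    rw [norm_smul]
    gcongr
    exact hU _
  have hpow (k : ℤ) : χ (U (.ofAdd k)) = χ (U (.ofAdd 1)) ^ k := by
    have hV : Units.map (χ : A →* ℂ) (U.toHomUnits (.ofAdd k))
        = Units.map (χ : A →* ℂ) (U.toHomUnits (.ofAdd 1)) ^ k := by
      rw [← map_zpow, ← map_zpow, ← ofAdd_zsmul]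
      simp
    simpa using congrArg Units.val hV
  set z := χ (U (.ofAdd 1)) with hz
  have hbd (k : ℤ) : ‖z‖ ^ k ≤ C * ‖(1 : A)‖ := by
    rw [← norm_zpow, ← hpow]
    refine (AlgHom.norm_apply_le_self_mul_norm_one χ _).trans ?_
    gcongr
    exact hU _
  have hz0 : z ≠ 0 := by
    intro h0
    have h1 : U (.ofAdd 1) * U (.ofAdd (-1)) = 1 := by
      rw [← map_mul, ← ofAdd_add, add_neg_cancel, ofAdd_zero, map_one]
    have h2 := congrArg χ h1
    rw [map_mul, map_one χ, ← hz, h0, zero_mul] at h2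
    exact zero_ne_one h2
  have hz1 : ‖z‖ = 1 := by
    refine le_antisymm ?_ ?_
    · by_contra! hlt
      obtain ⟨n, hn⟩ := pow_unbounded_of_one_lt (C * ‖(1 : A)‖) hlt
      have := hbd n
      rw [zpow_natCast] at this
      linarith
    · by_contra! hlt
      obtain ⟨n, hn⟩ := pow_unbounded_of_one_lt (C * ‖(1 : A)‖)
        ((one_lt_inv₀ (norm_pos_iff.2 hz0)).2 hlt)
      have := hbd (-n)
      rw [zpow_neg, zpow_natCast, ← inv_pow] at this
      linarith
  obtain ⟨θ, hθ⟩ := (Complex.norm_eq_one_iff z).1 hz1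
  apply h θ
  rw [← hχ, (hsum.hasSum.map χ (map_continuous χ)).tsum_eq.symm]
  refine tsum_congr fun k => ?_
  simp only [Function.comp_apply, map_smul, smul_eq_mul, hpow, ← hθ, ← Complex.exp_int_mul]
  ring_nf

/-- Wiener's lemma for a bounded representation of `ℤ` in a Banach algebra. The bicommutant of
the image is a commutative Banach algebra, to which Gelfand theory applies. -/
theorem isUnit_tsum_smul {A : Type*} [NormedRing A] [NormedAlgebra ℂ A]
    [CompleteSpace A] (U : Multiplicative ℤ →* A) {C : ℝ} (hU : ∀ n, ‖U n‖ ≤ C)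
    {a : ℤ → ℂ} (ha : Summable fun k => ‖a k‖)
    (h : ∀ θ : ℝ, ∑' k : ℤ, a k * Complex.exp (Complex.I * k * θ) ≠ 0) :
    IsUnit (∑' k : ℤ, a k • U (.ofAdd k)) := by
  let S : Subalgebra ℂ A :=
    Subalgebra.centralizer ℂ (Subalgebra.centralizer ℂ (Set.range U) : Set A)
  have hUS (n) : U n ∈ S :=
    Set.subset_centralizer_centralizer (Set.mem_range_self n)
  have hcomm (x y : S) : x * y = y * x := by
    refine Subtype.ext (Set.centralizer_centralizer_comm_of_comm
      (S := Set.range U) ?_ (x : A) x.2 (y : A) y.2)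
    rintro _ ⟨m, rfl⟩ _ ⟨n, rfl⟩
    rw [← map_mul, ← map_mul, mul_comm]
  let : NormedCommRing S := { (inferInstance : NormedRing S) with mul_comm := hcomm }
  have hclosed : IsClosed (S : Set A) := Set.isClosed_centralizer _
  have : CompleteSpace S := hclosed.completeSpace_coe
  let : NormedAlgebra ℂ S := S.toNormedAlgebra
  let V : Multiplicative ℤ →* S := U.codRestrict S hUS
  have hV := isUnit_tsum_smul_of_commRing V (C := C) hU ha h
  have hsum : Summable fun k : ℤ => a k • V (.ofAdd k) := by
    refine .of_norm_bounded (ha.mul_right C) fun k => ?_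
    rw [norm_smul]
    gcongr
    exact hU _
  have hval := (hsum.hasSum.map S.val continuous_subtype_val).tsum_eq
  have := hV.map S.val
  rw [← hval] at this
  exact this

/-- The Banach space `ℓ¹(ℤ)` of absolutely summable sequences. -/
noncomputable abbrev WienerSeq := lp (fun _ : ℤ => ℂ) 1

theorem memℓp_one_iff {f : ℤ → ℂ} : Memℓp f 1 ↔ Summable fun k => ‖f k‖ := by
  rw [memℓp_gen_iff (by simp)]; simp

/-- Translation by `k` as a linear isometry of `ℓ¹(ℤ)`. -/
noncomputable def shiftIsometry (k : ℤ) : WienerSeq →ₗᵢ[ℂ] WienerSeq where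
  toFun x := ⟨fun n => x (n - k),
    memℓp_one_iff.2 ((Equiv.subRight k).summable_iff.2 (memℓp_one_iff.1 x.2))⟩
  map_add' _ _ := rfl
  map_smul' _ _ := rfl
  norm_map' x := by
    rw [lp.norm_eq_tsum_rpow (by simp), lp.norm_eq_tsum_rpow (by simp)]
    simp only [ENNReal.toReal_one, Real.rpow_one, div_one]
    exact (Equiv.subRight k).tsum_eq fun n => ‖x n‖

/-- Translation by `k` as a bounded operator on `ℓ¹(ℤ)`. -/
noncomputable def shift (k : ℤ) : WienerSeq →L[ℂ] WienerSeq :=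
  (shiftIsometry k).toContinuousLinearMap

theorem shift_apply (k : ℤ) (x : WienerSeq) (n : ℤ) : shift k x n = x (n - k) := rfl

/-- The representation of `ℤ` on `ℓ¹(ℤ)` by translations. -/
noncomputable def shiftHom : Multiplicative ℤ →* (WienerSeq →L[ℂ] WienerSeq) where
  toFun k := shift k.toAdd
  map_one' := by ext x n; simp [shift_apply]
  map_mul' k l := by
    ext x n
    simp [shift_apply, sub_sub]

theorem norm_shiftHom_le (k : Multiplicative ℤ) : ‖shiftHom k‖ ≤ 1 :=
  (shiftIsometry k.toAdd).norm_toContinuousLinearMap_le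

/-- **Wiener's lemma**: an absolutely summable sequence whose Fourier series has no zeros has an
absolutely summable convolution inverse. -/
theorem exists_convolution_inverse {a : ℤ → ℂ} (ha : Summable fun k => ‖a k‖)
    (h : ∀ θ : ℝ, ∑' k : ℤ, a k * Complex.exp (Complex.I * k * θ) ≠ 0) :
    ∃ b : ℤ → ℂ, (Summable fun k => ‖b k‖) ∧
      ∀ n, HasSum (fun k => a k * b (n - k)) (if n = 0 then 1 else 0) := by
  obtain ⟨u, hu⟩ := isUnit_tsum_smul shiftHom norm_shiftHom_le ha h
  have hsum : Summable fun k : ℤ => a k • shiftHom (.ofAdd k) := by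
    refine .of_norm_bounded ha fun k => ?_
    rw [norm_smul]
    exact mul_le_of_le_one_right (norm_nonneg _) (norm_shiftHom_le _)
  let e : WienerSeq := lp.single 1 0 1
  let x : WienerSeq := (↑u⁻¹ : WienerSeq →L[ℂ] WienerSeq) e
  have hx : (u : WienerSeq →L[ℂ] WienerSeq) x = e := by
    change ((u : WienerSeq →L[ℂ] WienerSeq) * (↑u⁻¹ : WienerSeq →L[ℂ] WienerSeq)) e = e
    simp
  refine ⟨x, memℓp_one_iff.1 x.2, fun n => ?_⟩
  let L : (WienerSeq →L[ℂ] WienerSeq) →L[ℂ] ℂ :=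
    (lp.evalCLM ℂ (fun _ : ℤ => ℂ) 1 n).comp (ContinuousLinearMap.apply ℂ WienerSeq x)
  have := hsum.hasSum.mapL L
  rw [← hu] at this
  have hL : L u = if n = 0 then 1 else 0 := by
    change ((u : WienerSeq →L[ℂ] WienerSeq) x) n = _
    rw [hx]
    simp only [e, lp.single_apply, Pi.single_apply]
  rw [hL] at this
  exact this

theorem hasSum_of_summable_fourier_coeff {φ : ℝ → ℂ} (hφc : Continuous φ)
    (hφp : Function.Periodic φ (2 * π)) {a : ℤ → ℂ}
    (ha : ∀ k : ℤ, a k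
      = (1 / (2 * π)) * ∫ θ in (0:ℝ)..(2 * π), φ θ * Complex.exp (-(Complex.I * k * θ)))
    (haW : Summable fun k : ℤ => ‖a k‖) (θ : ℝ) :
    HasSum (fun k : ℤ => a k * Complex.exp (Complex.I * k * θ)) (φ θ) := by
  have : Fact (0 < 2 * π) := ⟨Real.two_pi_pos⟩
  let f : C(AddCircle (2 * π), ℂ) := ⟨hφp.lift, continuous_coinduced_dom.2 hφc⟩
  have hf (x : ℝ) : f (x : AddCircle (2 * π)) = φ x := rfl
  have hexp (k : ℤ) (x : ℝ) :
      fourier k (x : AddCircle (2 * π)) = Complex.exp (Complex.I * k * x) := by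
    rw [fourier_coe_apply]
    congr 1
    push_cast
    field_simp
  have hfa : fourierCoeff f = a := by
    ext k
    rw [fourierCoeff_eq_intervalIntegral f k 0, ha]
    simp only [zero_add, hexp, hf, smul_eq_mul, Complex.real_smul]
    push_cast
    congr 2
    ext x
    rw [mul_comm]
    ring_nf
  have := has_pointwise_sum_fourier_series_of_summable (f := f)
    (by rw [hfa]; exact haW.of_norm) θ
  simpa only [hfa, hexp, hf, smul_eq_mul] using this

theorem integral_exp_I_mul_int (n : ℤ) :
    ∫ θ in (0:ℝ)..(2 * π), Complex.exp (Complex.I * n * θ) = if n = 0 then 2 * π else 0 := by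
  split_ifs with hn
  · simp [hn]
  · rw [integral_exp_mul_complex (by simp [hn])]
    have : Complex.I * n * ((2 * π : ℝ) : ℂ) = n * (2 * π * Complex.I) := by push_cast; ring
    rw [this, Complex.exp_int_mul_two_pi_mul_I]
    simp

theorem fourier_coeff_of_hasSum {ψ : ℝ → ℂ} {b : ℤ → ℂ} (hb : Summable fun k => ‖b k‖)
    (hψ : ∀ θ : ℝ, HasSum (fun k : ℤ => b k * Complex.exp (Complex.I * k * θ)) (ψ θ)) (k : ℤ) :
    (1 / (2 * π)) * ∫ θ in (0:ℝ)..(2 * π), ψ θ * Complex.exp (-(Complex.I * k * θ)) = b k := by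
  have h := intervalIntegral.hasSum_integral_of_dominated_convergence (a := 0) (b := 2 * π)
    (μ := MeasureTheory.volume)
    (F := fun (m : ℤ) (θ : ℝ) => b m * Complex.exp (Complex.I * (m - k : ℤ) * θ))
    (f := fun θ => ψ θ * Complex.exp (-(Complex.I * k * θ)))
    (fun m _ => ‖b m‖) (fun m => (by fun_prop : Continuous _).aestronglyMeasurable)
    (fun m => .of_forall fun θ _ => by
      rw [norm_mul, show Complex.I * (m - k : ℤ) * θ = ((m - k : ℤ) * θ : ℝ) * Complex.I by
        push_cast; ring, Complex.norm_exp_ofReal_mul_I, mul_one])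
    (.of_forall fun _ _ => hb) (by simp)
    (.of_forall fun θ _ => by
      refine ((hψ θ).mul_right (Complex.exp (-(Complex.I * k * θ)))).congr_fun fun m => ?_
      rw [mul_assoc (b m) (Complex.exp (Complex.I * m * θ)), ← Complex.exp_add]
      congr 2
      push_cast
      ring)
  simp only [intervalIntegral.integral_const_mul, integral_exp_I_mul_int, sub_eq_zero] at h
  rw [h.unique (hasSum_single k fun m hm => by simp [hm])]
  have : (π : ℂ) ≠ 0 := by exact_mod_cast Real.pi_ne_zero
  rw [if_pos rfl]
  push_cast
  field_simp

theorem hasSum_convolution {u v c : ℤ → ℂ} (hu : Summable fun k => ‖u k‖)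
    (hv : Summable fun k => ‖v k‖) (huv : ∀ n, HasSum (fun k : ℤ => u k * v (n - k)) (c n))
    {z w : ℂ} (hz : HasSum u z) (hw : HasSum v w) : HasSum c (z * w) := by
  have hs : Summable fun p : ℤ × ℤ => u p.1 * v p.2 := summable_mul_of_summable_norm hu hv
  let e : ℤ × ℤ ≃ ℤ × ℤ :=
    { toFun := fun p => (p.2, p.1 - p.2)
      invFun := fun p => (p.1 + p.2, p.1)
      left_inv := fun p => by simp
      right_inv := fun p => by simp }
  exact (e.hasSum_iff.2 (hz.mul hw hs)).prod_fiberwise huv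

theorem hasSum_inv_of_convolution {a b : ℤ → ℂ} (ha : Summable fun k => ‖a k‖)
    (hb : Summable fun k => ‖b k‖)
    (hab : ∀ n, HasSum (fun k : ℤ => a k * b (n - k)) (if n = 0 then 1 else 0)) {z : ℂ} {θ : ℝ}
    (hz : HasSum (fun k : ℤ => a k * Complex.exp (Complex.I * k * θ)) z) :
    HasSum (fun k : ℤ => b k * Complex.exp (Complex.I * k * θ)) z⁻¹ := by
  have hexp (k : ℤ) : ‖Complex.exp (Complex.I * k * θ)‖ = 1 := by
    rw [show Complex.I * k * θ = ((k * θ : ℝ) : ℂ) * Complex.I by push_cast; ring,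
      Complex.norm_exp_ofReal_mul_I]
  have ha' : Summable fun k : ℤ => ‖a k * Complex.exp (Complex.I * k * θ)‖ := by
    simpa only [norm_mul, hexp, mul_one] using ha
  have hb' : Summable fun k : ℤ => ‖b k * Complex.exp (Complex.I * k * θ)‖ := by
    simpa only [norm_mul, hexp, mul_one] using hb
  obtain ⟨w, hw⟩ := hb'.of_norm
  have hprod := hasSum_convolution
    (c := fun n : ℤ => (if n = 0 then 1 else 0) * Complex.exp (Complex.I * n * θ)) ha' hb'
    (fun n => by
      refine ((hab n).mul_right (Complex.exp (Complex.I * n * θ))).congr_fun fun k => ?_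
      rw [mul_mul_mul_comm, ← Complex.exp_add]
      congr 2
      push_cast
      ring) hz hw
  have hzw : z * w = 1 := by
    rw [hprod.unique (hasSum_single 0 fun n hn => by simp [hn])]
    simp
  rwa [inv_eq_of_mul_eq_one_right hzw]

theorem hasSum_toeplitz_add_hankel {a b : ℤ → ℂ}
    (haE : ∀ k, a (-k) = a k) (hbE : ∀ k, b (-k) = b k)
    (hab : ∀ n, HasSum (fun k : ℤ => a k * b (n - k)) (if n = 0 then 1 else 0)) (j k : ℕ) :
    HasSum (fun l : ℕ =>
      (a ((j:ℤ) - l) + a ((j:ℤ) + l + 1)) * (b ((l:ℤ) - k) + b ((l:ℤ) + k + 1)))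
      (if j = k then 1 else 0) := by
  have h₁ : HasSum (fun l : ℤ => a (j - l) * b (l - k)) (if j = k then 1 else 0) := by
    convert (Equiv.subLeft (j : ℤ)).hasSum_iff.2 (hab (j - k)) using 2 with l
    · simp only [Function.comp_apply, Equiv.subLeft_apply]
      congr 2
      ring
    · simp [sub_eq_zero]
  have h₂ : HasSum (fun l : ℤ => a (j + l + 1) * b (l - k)) 0 := by
    convert (Equiv.subLeft (-j - 1 : ℤ)).hasSum_iff.2 (hab (-j - 1 - k)) using 2 with l
    · simp only [Function.comp_apply, Equiv.subLeft_apply]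
      rw [← haE]
      congr 2 <;> ring
    · rw [if_neg (by lia)]
  have h := (h₁.add h₂).nat_add_neg_add_one
  rw [add_zero] at h
  convert h using 2 with l
  have e₁ : (j : ℤ) - -(l + 1) = j + l + 1 := by ring
  have e₂ : (j : ℤ) + -(l + 1) + 1 = j - l := by ring
  have e₃ : b (-(l + 1) - k) = b (l + k + 1) := by rw [← hbE]; congr 1; ring
  rw [e₁, e₂, e₃]
  ring

theorem even_of_hasSum_fourier {φ : ℝ → ℂ} {a : ℤ → ℂ} (haE : ∀ k, a (-k) = a k)
    (hφ : ∀ θ : ℝ, HasSum (fun k : ℤ => a k * Complex.exp (Complex.I * k * θ)) (φ θ)) (θ : ℝ) :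
    φ (-θ) = φ θ := by
  refine (hφ (-θ)).unique (((Equiv.neg ℤ).hasSum_iff.2 (hφ θ)).congr_fun fun k => ?_)
  simp [haE]

theorem fourier_coeff_even {ψ : ℝ → ℂ} {b : ℤ → ℂ} (hb : Summable fun k => ‖b k‖)
    (hψ : ∀ θ : ℝ, HasSum (fun k : ℤ => b k * Complex.exp (Complex.I * k * θ)) (ψ θ))
    (hψE : ∀ θ, ψ (-θ) = ψ θ) (k : ℤ) : b (-k) = b k := by
  rw [← fourier_coeff_of_hasSum hb hψ k, eq_comm]
  refine fourier_coeff_of_hasSum (b := fun k => b (-k)) ((Equiv.neg ℤ).summable_iff.2 hb)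
    (fun θ => ?_) k
  rw [← hψE]
  refine ((Equiv.neg ℤ).hasSum_iff.2 (hψ (-θ))).congr_fun fun m => ?_
  simp

/-- **Entrywise form of `(T(φ)+H(φ))(T(φ⁻¹)+H(φ⁻¹)) = I`.**
`φ` is a continuous nonvanishing `2π`-periodic function (viewed as a function on the
unit circle via `θ ↦ φ(e^{iθ})`) lying in the Wiener algebra and even, `a` is its
sequence of Fourier coefficients, and `b` is the sequence of Fourier coefficients of
`ψ = 1/φ`.  Then `ψ` also lies in the Wiener algebra and for all `j, k ∈ ℤ≥0`,
`∑_{l≥0} (φ̂(j−l) + φ̂(j+l+1))(ψ̂(l−k) + ψ̂(l+k+1)) = δ_{jk}`, the series converging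
absolutely. -/
theorem wiener_hopf_hankel_inverse_entrywise
    (φ : ℝ → ℂ) (hφc : Continuous φ) (hφp : Function.Periodic φ (2 * π))
    (hφ0 : ∀ θ : ℝ, φ θ ≠ 0)
    (a : ℤ → ℂ)
    (ha : ∀ k : ℤ, a k
      = (1 / (2 * π)) * ∫ θ in (0:ℝ)..(2 * π), φ θ * Complex.exp (-(Complex.I * k * θ)))
    (haW : Summable fun k : ℤ => ‖a k‖)
    (heven : ∀ k : ℤ, a (-k) = a k)
    (b : ℤ → ℂ)
    (hb : ∀ k : ℤ, b k
      = (1 / (2 * π)) * ∫ θ in (0:ℝ)..(2 * π), (φ θ)⁻¹ * Complex.exp (-(Complex.I * k * θ))) :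
    (Summable fun k : ℤ => ‖b k‖) ∧
    ∀ j k : ℕ,
      (Summable fun l : ℕ =>
        ‖(a ((j:ℤ) - l) + a ((j:ℤ) + l + 1)) * (b ((l:ℤ) - k) + b ((l:ℤ) + k + 1))‖) ∧
      (∑' l : ℕ, (a ((j:ℤ) - l) + a ((j:ℤ) + l + 1)) * (b ((l:ℤ) - k) + b ((l:ℤ) + k + 1)))
        = if j = k then 1 else 0 := by
  have hφ := hasSum_of_summable_fourier_coeff hφc hφp ha haW
  obtain ⟨b', hb', hab⟩ := exists_convolution_inverse haW fun θ => by
    rw [(hφ θ).tsum_eq]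
    exact hφ0 θ
  have hψ (θ : ℝ) := hasSum_inv_of_convolution haW hb' hab (hφ θ)
  obtain rfl : b = b' := funext fun k => (hb k).trans (fourier_coeff_of_hasSum hb' hψ k)
  have hbE := fourier_coeff_even hb' hψ fun θ => by rw [even_of_hasSum_fourier heven hφ]
  refine ⟨hb', fun j k => ?_⟩
  have h := hasSum_toeplitz_add_hankel heven hbE hab j k
  exact ⟨h.summable.norm, h.tsum_eq⟩
end

section
/- Let φ⁺ and φ⁻ be continuous nonvanishing functions on the unit circle lying in the Wiener algebra such that φ̂⁺(k) = 0 for all k < 0, φ̂⁻(k) = 0 for all k > 0, and φ⁻(z) = φ⁺(z⁻¹) (equivalently φ̂⁻(−k) = φ̂⁺(k) for all k). Set φ = φ⁺φ⁻ and assume that ψ := 1/φ and χ := φ⁻/φ⁺ also lie in the Wiener algebra. Then for all j, k ∈ ℤ≥0 one has ∑_{l=0}^{∞} ∑_{m=0}^{∞} φ̂⁻(j−l) · ψ̂(l+m+1) · φ̂⁺(m−k) = χ̂(j+k+1), with the double series converging absolutely. (This is the entrywise form of the operator identity T(φ⁻) H(φ⁻¹) T(φ⁺) = H(φ⁻/φ⁺).)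 -/
open Complex Real

/-- The `n`-th Fourier coefficient of a function of the angle `θ`. -/
noncomputable def angleCoeff (f : ℝ → ℂ) (n : ℤ) : ℂ :=
  (1 / (2 * π)) * ∫ θ in (0:ℝ)..(2 * π), f θ * Complex.exp (-(Complex.I * n * θ))

lemma norm_exp_I_mul_int_mul (n : ℤ) (θ : ℝ) : ‖Complex.exp (Complex.I * n * θ)‖ = 1 := by
  have h : Complex.I * n * θ = ((n * θ : ℝ) : ℂ) * Complex.I := by
    push_cast
    ring
  rw [h, Complex.norm_exp_ofReal_mul_I]

/-- A continuous periodic function with summable Fourier coefficients is the sum of its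
Fourier series. -/
lemma hasSum_angleCoeff_mul_exp {f : ℝ → ℂ} (hf : Continuous f)
    (hper : Function.Periodic f (2 * π)) (hs : Summable (angleCoeff f)) (θ : ℝ) :
    HasSum (fun k : ℤ => angleCoeff f k * Complex.exp (Complex.I * k * θ)) (f θ) := by
  have : Fact (0 < 2 * π) := ⟨Real.two_pi_pos⟩
  have hexp (k : ℤ) (t : ℝ) :
      fourier k (t : AddCircle (2 * π)) = Complex.exp (Complex.I * k * t) := by
    rw [fourier_coe_apply]
    congr 1
    push_cast
    field_simp
  let F : C(AddCircle (2 * π), ℂ) := ⟨hper.lift, hf.quotient_lift _⟩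
  have hF (t : ℝ) : F (t : AddCircle (2 * π)) = f t := hper.lift_coe t
  have hcoeff : fourierCoeff F = angleCoeff f := by
    ext n
    rw [fourierCoeff_eq_intervalIntegral _ n 0, angleCoeff, zero_add, Complex.real_smul]
    push_cast
    congr 1
    refine intervalIntegral.integral_congr fun t _ => ?_
    simp only [hF, hexp, smul_eq_mul]
    push_cast
    rw [mul_comm]
    congr 2
    ring
  have h := has_pointwise_sum_fourier_series_of_summable (f := F) (hcoeff ▸ hs) θ
  simpa only [hcoeff, hexp, hF, smul_eq_mul] using h

/-- The Fourier coefficients of a product are the convolution of the Fourier coefficients,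
provided one factor lies in the Wiener algebra. -/
lemma hasSum_angleCoeff_mul {f g : ℝ → ℂ} (hf : Continuous f)
    (hper : Function.Periodic f (2 * π)) (hs : Summable (angleCoeff f))
    (hg : Continuous g) (n : ℤ) :
    HasSum (fun k : ℤ => angleCoeff f k * angleCoeff g (n - k))
      (angleCoeff (fun θ => f θ * g θ) n) := by
  have key : HasSum
      (fun k : ℤ => ∫ θ in (0:ℝ)..(2 * π),
        angleCoeff f k * (g θ * Complex.exp (-(Complex.I * (n - k : ℤ) * θ))))
      (∫ θ in (0:ℝ)..(2 * π), f θ * g θ * Complex.exp (-(Complex.I * n * θ))) := by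
    refine intervalIntegral.hasSum_integral_of_dominated_convergence
      (fun k θ => ‖angleCoeff f k‖ * ‖g θ‖) (fun k => ?_) (fun k => ?_) ?_ ?_ ?_
    · exact Continuous.aestronglyMeasurable (by fun_prop)
    · refine Filter.Eventually.of_forall fun θ _ => le_of_eq ?_
      rw [norm_mul, norm_mul, Complex.exp_neg, norm_inv, norm_exp_I_mul_int_mul, inv_one, mul_one]
    · exact Filter.Eventually.of_forall fun θ _ => hs.norm.mul_right _
    · simp only [tsum_mul_right]
      exact Continuous.intervalIntegrable (by fun_prop) _ _
    · refine Filter.Eventually.of_forall fun θ _ => ?_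
      have h := (hasSum_angleCoeff_mul_exp hf hper hs θ).mul_right
        (g θ * Complex.exp (-(Complex.I * n * θ)))
      rw [← mul_assoc] at h
      convert! h using 2 with k
      have : Complex.exp (-(Complex.I * (n - k : ℤ) * θ))
          = Complex.exp (Complex.I * k * θ) * Complex.exp (-(Complex.I * n * θ)) := by
        rw [← Complex.exp_add]
        congr 1
        push_cast
        ring
      rw [this]
      ring
  have h := key.mul_left (1 / (2 * (π : ℂ)))
  convert! h using 2 with k
  rw [intervalIntegral.integral_const_mul, angleCoeff.eq_def g]
  ring

/-- **Entrywise form of the identity `T(φ⁻) H(φ⁻¹) T(φ⁺) = H(φ⁻/φ⁺)`.**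
`φ⁺, φ⁻` are continuous nonvanishing `2π`-periodic functions (viewed as functions on the
unit circle via `θ ↦ φ^±(e^{iθ})`) in the Wiener algebra, with Fourier coefficient
sequences `ap, am` satisfying `ap k = 0` for `k < 0`, `am k = 0` for `k > 0` and
`am (−k) = ap k`; `b` is the Fourier coefficient sequence of `ψ = 1/(φ⁺φ⁻)`, and `x`
that of `χ = φ⁻/φ⁺`, both assumed to lie in the Wiener algebra.  Then for all
`j, k ∈ ℤ≥0`, `∑_{l,m≥0} φ̂⁻(j−l) ψ̂(l+m+1) φ̂⁺(m−k) = χ̂(j+k+1)`, the double series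
converging absolutely. -/
theorem toeplitz_hankel_toeplitz_identity_entrywise
    (φp φm : ℝ → ℂ) (hpc : Continuous φp) (hmc : Continuous φm)
    (hpp : Function.Periodic φp (2 * π)) (hmp : Function.Periodic φm (2 * π))
    (hp0 : ∀ θ : ℝ, φp θ ≠ 0) (hm0 : ∀ θ : ℝ, φm θ ≠ 0)
    (ap am b x : ℤ → ℂ)
    (hap : ∀ k : ℤ, ap k
      = (1 / (2 * π)) * ∫ θ in (0:ℝ)..(2 * π), φp θ * Complex.exp (-(Complex.I * k * θ)))
    (ham : ∀ k : ℤ, am k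
      = (1 / (2 * π)) * ∫ θ in (0:ℝ)..(2 * π), φm θ * Complex.exp (-(Complex.I * k * θ)))
    (hb : ∀ k : ℤ, b k
      = (1 / (2 * π)) * ∫ θ in (0:ℝ)..(2 * π),
          (φp θ * φm θ)⁻¹ * Complex.exp (-(Complex.I * k * θ)))
    (hx : ∀ k : ℤ, x k
      = (1 / (2 * π)) * ∫ θ in (0:ℝ)..(2 * π),
          (φm θ / φp θ) * Complex.exp (-(Complex.I * k * θ)))
    (hapW : Summable fun k : ℤ => ‖ap k‖)
    (hamW : Summable fun k : ℤ => ‖am k‖)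
    (hbW : Summable fun k : ℤ => ‖b k‖)
    (hxW : Summable fun k : ℤ => ‖x k‖)
    (hplus : ∀ k : ℤ, k < 0 → ap k = 0)
    (hminus : ∀ k : ℤ, 0 < k → am k = 0)
    (hrel : ∀ k : ℤ, am (-k) = ap k) :
    ∀ j k : ℕ,
      (Summable fun p : ℕ × ℕ =>
        ‖am ((j:ℤ) - p.1) * b ((p.1:ℤ) + p.2 + 1) * ap ((p.2:ℤ) - k)‖) ∧
      (∑' p : ℕ × ℕ, am ((j:ℤ) - p.1) * b ((p.1:ℤ) + p.2 + 1) * ap ((p.2:ℤ) - k))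
        = x ((j:ℤ) + k + 1) := by
  obtain rfl : ap = angleCoeff φp := funext hap
  obtain rfl : am = angleCoeff φm := funext ham
  obtain rfl : b = angleCoeff fun θ => (φp θ * φm θ)⁻¹ := funext hb
  obtain rfl : x = angleCoeff fun θ => φm θ / φp θ := funext hx
  set ψ : ℝ → ℂ := fun θ => (φp θ * φm θ)⁻¹ with hψ
  have hψc : Continuous ψ := (hpc.mul hmc).inv₀ fun θ => mul_ne_zero (hp0 θ) (hm0 θ)
  have hms : Summable (angleCoeff φm) := hamW.of_norm
  intro j k
  have hquot : (fun θ => φm θ * (φm θ * ψ θ)) = fun θ => φm θ / φp θ := by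
    funext θ
    have := hp0 θ
    have := hm0 θ
    simp only [hψ]
    field_simp
  have hsummable : Summable fun q : ℤ × ℤ => ‖angleCoeff φm q.1 *
      (angleCoeff φm q.2 * angleCoeff ψ ((j:ℤ) + k + 1 - q.1 - q.2))‖ := by
    refine Summable.of_nonneg_of_le (fun _ => norm_nonneg _) (fun q => ?_)
      ((hms.norm.mul_of_nonneg hms.norm (fun _ => norm_nonneg _)
        (fun _ => norm_nonneg _)).mul_right (∑' n, ‖angleCoeff ψ n‖))
    rw [norm_mul, norm_mul, ← mul_assoc]
    gcongr
    exact hbW.le_tsum _ fun _ _ => norm_nonneg _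
  have hsum : HasSum (fun q : ℤ × ℤ => angleCoeff φm q.1 *
      (angleCoeff φm q.2 * angleCoeff ψ ((j:ℤ) + k + 1 - q.1 - q.2)))
      (angleCoeff (fun θ => φm θ / φp θ) ((j:ℤ) + k + 1)) := by
    have h := hsummable.of_norm.hasSum
    have h' := h.prod_fiberwise fun s =>
      (hasSum_angleCoeff_mul hmc hmp hms hψc ((j:ℤ) + k + 1 - s)).mul_left (angleCoeff φm s)
    have h'' := hasSum_angleCoeff_mul hmc hmp hms
      (g := fun θ => φm θ * ψ θ) (hmc.mul hψc) ((j:ℤ) + k + 1)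
    rw [hquot] at h''
    rwa [h'.unique h''] at h
  let e : ℕ × ℕ → ℤ × ℤ := fun p => ((j:ℤ) - p.1, (k:ℤ) - p.2)
  have he : Function.Injective e := by
    rintro ⟨l, m⟩ ⟨l', m'⟩ h
    simp only [e, Prod.mk.injEq] at h ⊢
    omega
  have hzero : ∀ q ∉ Set.range e, angleCoeff φm q.1 *
      (angleCoeff φm q.2 * angleCoeff ψ ((j:ℤ) + k + 1 - q.1 - q.2)) = 0 := by
    rintro ⟨s, r⟩ hq
    rcases lt_or_ge (j:ℤ) s with hs | hs
    · simp [hminus s (by omega)]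
    rcases lt_or_ge (k:ℤ) r with hr | hr
    · simp [hminus r (by omega)]
    refine absurd ⟨(((j:ℤ) - s).toNat, ((k:ℤ) - r).toNat), ?_⟩ hq
    simp only [e, Prod.mk.injEq]
    omega
  have hterm (p : ℕ × ℕ) : angleCoeff φm ((j:ℤ) - p.1) * angleCoeff ψ ((p.1:ℤ) + p.2 + 1)
      * angleCoeff φp ((p.2:ℤ) - k) = angleCoeff φm (e p).1 * (angleCoeff φm (e p).2
        * angleCoeff ψ ((j:ℤ) + k + 1 - (e p).1 - (e p).2)) := by
    have h1 : (j:ℤ) + k + 1 - (e p).1 - (e p).2 = (p.1:ℤ) + p.2 + 1 := by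
      simp only [e]
      ring
    rw [h1, ← hrel, neg_sub]
    ring
  simp only [hterm]
  exact ⟨hsummable.comp_injective he, ((he.hasSum_iff hzero).mpr hsum).tsum_eq⟩
end

section
/- Let α ∈ ℂ and r ∈ (0,1). Define ξ(r) = i(1−ir)/(1+ir), and for real ξ set σ_r(ξ) = exp(α·(Log(ξ−ξ(r)) − Log(ξ−conj(ξ(r))) + Log(ξ+ξ(r)) − Log(ξ+conj(ξ(r))))). For z on the unit circle set φ_r(z) = exp(α·(Log(1−irz) − Log(1+irz) + Log(1−irz⁻¹) − Log(1+irz⁻¹))) (each of the four arguments has positive real part, so the principal logarithms are well defined). Then for every real ξ, with z(ξ) = (1+iξ)/(1−iξ) (a point of the unit circle), one has φ_r(z(ξ)) = exp(2α·Log((1+ir)/(1−ir))) · σ_r(ξ). -/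
open Complex

/-- The linear-fractional map `ξ(x) = i(1−ix)/(1+ix)`, mapping `[−1,1]` onto the upper
half of the unit circle. -/
noncomputable def xiMap (x : ℝ) : ℂ :=
  Complex.I * (1 - Complex.I * x) / (1 + Complex.I * x)

/-- The regularized two-jump symbol
`σ_r(ξ) = exp(α(Log(ξ−ξ(r)) − Log(ξ−conj ξ(r)) + Log(ξ+ξ(r)) − Log(ξ+conj ξ(r))))`,
where `Log` is the principal branch of the complex logarithm. -/
noncomputable def sigmaReg (α : ℂ) (r : ℝ) (t : ℝ) : ℂ :=
  Complex.exp (α * (Complex.log ((t:ℂ) - xiMap r) - Complex.log ((t:ℂ) - (starRingEnd ℂ) (xiMap r))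
    + Complex.log ((t:ℂ) + xiMap r) - Complex.log ((t:ℂ) + (starRingEnd ℂ) (xiMap r))))

/-- The regularized Toeplitz symbol
`φ_r(z) = exp(α(Log(1−irz) − Log(1+irz) + Log(1−irz⁻¹) − Log(1+irz⁻¹)))`. -/
noncomputable def phiReg (α : ℂ) (r : ℝ) (z : ℂ) : ℂ :=
  Complex.exp (α * (Complex.log (1 - Complex.I * r * z) - Complex.log (1 + Complex.I * r * z)
    + Complex.log (1 - Complex.I * r * z⁻¹) - Complex.log (1 + Complex.I * r * z⁻¹)))

/-- On the slit plane, `Log w - Log (conj w)` is `2i` times the argument of `w`. -/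
theorem log_sub_log_conj {w : ℂ} (hw : w ∈ slitPlane) :
    log w - log (starRingEnd ℂ w) = 2 * (arg w : ℂ) * I := by
  rw [log_conj _ (mem_slitPlane_iff_arg.1 hw).1, sub_conj, log_im]
  push_cast
  ring

/-- In the right half plane, `Log (w / conj w)` is `2i` times the argument of `w`. -/
theorem log_div_conj {w : ℂ} (hw : 0 < w.re) :
    log (w / starRingEnd ℂ w) = 2 * (arg w : ℂ) * I := by
  have h0 : w ≠ 0 := fun h => by simp [h] at hw
  have h1 : starRingEnd ℂ w ≠ 0 := by simpa using h0
  have h2 := abs_lt.1 (abs_arg_lt_pi_div_two_iff.2 (Or.inl hw))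
  have him : (2 * (arg w : ℂ) * I).im = 2 * arg w := by simp
  rw [← log_exp (x := 2 * (arg w : ℂ) * I) (by rw [him]; linarith [h2.1])
    (by rw [him]; linarith [h2.2]), ← log_sub_log_conj (Or.inl hw), exp_sub, exp_log h0,
    exp_log h1]

/-- On a horizontal line in the upper half plane the argument decreases to the right. -/
theorem arg_le_arg_of_im_eq {u v : ℂ} (hu : 0 < u.im) (him : u.im = v.im) (hre : v.re ≤ u.re) :
    arg u ≤ arg v := by
  have hv : 0 < v.im := him ▸ hu
  have hu0 : u ≠ 0 := fun h => by simp [h] at hu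
  have hv0 : v ≠ 0 := fun h => by simp [h] at hv
  have bu := arg_nonneg_iff.2 hu.le
  have bv := arg_nonneg_iff.2 hv.le
  have bu' := (arg_lt_pi_iff (z := u)).2 (Or.inr hu.ne')
  have bv' := (arg_lt_pi_iff (z := v)).2 (Or.inr hv.ne')
  have hc : arg (starRingEnd ℂ u) = -arg u := by rw [arg_conj, if_neg bu'.ne]
  have hmul : arg (v * starRingEnd ℂ u) = arg v + arg (starRingEnd ℂ u) :=
    arg_mul hv0 (by simpa using hu0) ⟨by rw [hc]; linarith, by rw [hc]; linarith⟩
  have hnn : 0 ≤ arg (v * starRingEnd ℂ u) := by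
    rw [arg_nonneg_iff, mul_im, conj_re, conj_im, him]
    nlinarith
  rw [hmul, hc] at hnn
  linarith

/-- If `p q v` is a positive multiple of `w² u`, the arguments add up without a multiple of `2π`,
provided the factors lie in suitable half planes. -/
theorem arg_add_arg_eq_of_mul_eq {p q w u v : ℂ} {a b : ℝ} (ha : 0 < a) (hb : 0 < b)
    (hp : 0 < p.re) (hq : 0 < q.re) (hw : 0 < w.re) (hw' : 0 < w.im) (hu : 0 < u.im)
    (hv : 0 < v.im) (huv : arg u ≤ arg v) (h : a * (p * q * v) = b * (w * w * u)) :
    arg p + arg q = 2 * arg w + arg u - arg v := by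
  have ne_re : ∀ {x : ℂ}, 0 < x.re → x ≠ 0 := fun hx h0 => by simp [h0] at hx
  have ne_im : ∀ {x : ℂ}, 0 < x.im → x ≠ 0 := fun hx h0 => by simp [h0] at hx
  have bp := abs_lt.1 (abs_arg_lt_pi_div_two_iff.2 (Or.inl hp))
  have bq := abs_lt.1 (abs_arg_lt_pi_div_two_iff.2 (Or.inl hq))
  have bw := abs_lt.1 (abs_arg_lt_pi_div_two_iff.2 (Or.inl hw))
  have bw' := arg_nonneg_iff.2 hw'.le
  have bu := arg_nonneg_iff.2 hu.le
  have bv := arg_nonneg_iff.2 hv.le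
  have bu' := (arg_lt_pi_iff (z := u)).2 (Or.inr hu.ne')
  have bv' := (arg_lt_pi_iff (z := v)).2 (Or.inr hv.ne')
  have harg : (((arg p + arg q + arg v : ℝ)) : Real.Angle)
      = ((arg w + arg w + arg u : ℝ) : Real.Angle) := by
    simp only [Real.Angle.coe_add]
    rw [← arg_mul_coe_angle (ne_re hp) (ne_re hq),
      ← arg_mul_coe_angle (mul_ne_zero (ne_re hp) (ne_re hq)) (ne_im hv),
      ← arg_mul_coe_angle (ne_re hw) (ne_re hw),
      ← arg_mul_coe_angle (mul_ne_zero (ne_re hw) (ne_re hw)) (ne_im hu),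
      ← arg_real_mul (p * q * v) ha, h, arg_real_mul _ hb]
  obtain ⟨k, hk⟩ := Real.Angle.angle_eq_iff_two_pi_dvd_sub.1 harg
  have hpi := Real.pi_pos
  have k1 : (k : ℝ) < 1 := by nlinarith
  have k2 : (-1 : ℝ) < k := by nlinarith
  have k0 : k = 0 := by
    have : k < 1 := by exact_mod_cast k1
    have : -1 < k := by exact_mod_cast k2
    omega
  rw [k0] at hk
  push_cast at hk
  linarith

/-- The map `xiMap` in terms of its real and imaginary parts. -/
theorem xiMap_eq (r : ℝ) :
    xiMap r = ((2 * r / (1 + r ^ 2) : ℝ) : ℂ) + ((1 - r ^ 2) / (1 + r ^ 2) : ℝ) * I := by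
  have h1 : (1 + I * r : ℂ) ≠ 0 := fun h => by simpa using congrArg re h
  have h2 : (1 + r ^ 2 : ℂ) ≠ 0 := by
    have : (1 + r ^ 2 : ℝ) ≠ 0 := by positivity
    exact_mod_cast this
  rw [xiMap]
  push_cast
  field_simp
  linear_combination (-2 * (r : ℂ)) * I_sq

/-- **Relation between the regularized Toeplitz and Wiener-Hopf symbols.**
For `α ∈ ℂ`, `r ∈ (0,1)` and real `ξ`, with `z(ξ) = (1+iξ)/(1−iξ)`,
`φ_r(z(ξ)) = exp(2α·Log((1+ir)/(1−ir))) · σ_r(ξ)`. -/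
theorem phiReg_eq_const_mul_sigmaReg (α : ℂ) (r : ℝ) (hr0 : 0 < r) (hr1 : r < 1) (t : ℝ) :
    phiReg α r ((1 + Complex.I * t) / (1 - Complex.I * t))
      = Complex.exp (2 * α * Complex.log ((1 + Complex.I * r) / (1 - Complex.I * r)))
        * sigmaReg α r t := by
  set z : ℂ := (1 + I * t) / (1 - I * t) with hz
  have ht1 : (1 + I * t : ℂ) ≠ 0 := fun h => by simpa using congrArg re h
  have ht2 : (1 - I * t : ℂ) ≠ 0 := fun h => by simpa using congrArg re h
  have hzc : starRingEnd ℂ z = z⁻¹ := by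
    simp [hz, ← sub_eq_add_neg]
  have hnorm : ‖z‖ = 1 := by
    have h := mul_conj z
    rw [hzc, mul_inv_cancel₀ (div_ne_zero ht1 ht2)] at h
    have h' : ‖z‖ ^ 2 = 1 := by
      rw [← normSq_eq_norm_sq]
      exact_mod_cast h.symm
    nlinarith [norm_nonneg z]
  have hre : ∀ x : ℂ, ‖x‖ = 1 → 0 < (1 - I * r * x).re := fun x hx => by
    have := abs_le.1 (abs_im_le_norm x)
    simp
    nlinarith
  have hp := hre z hnorm
  have hq := hre z⁻¹ (by simp [hnorm])
  have hpc : starRingEnd ℂ (1 - I * r * z) = 1 + I * r * z⁻¹ := by simp [hzc]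
  have hqc : starRingEnd ℂ (1 - I * r * z⁻¹) = 1 + I * r * z := by simp [← hzc]
  have hwc : starRingEnd ℂ (1 + I * r) = 1 - I * r := by simp [sub_eq_add_neg]
  have huc : starRingEnd ℂ (t + xiMap r) = t + starRingEnd ℂ (xiMap r) := by simp
  have hvc : starRingEnd ℂ (t - starRingEnd ℂ (xiMap r)) = t - xiMap r := by simp
  have hs : 0 < (1 - r ^ 2) / (1 + r ^ 2) := div_pos (by nlinarith) (by positivity)
  have him : (xiMap r).im = (1 - r ^ 2) / (1 + r ^ 2) := by
    rw [xiMap_eq, add_im, ofReal_im, im_ofReal_mul, I_im]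
    ring
  have hu : 0 < ((t : ℂ) + xiMap r).im := by simpa [him] using hs
  have hv : 0 < ((t : ℂ) - starRingEnd ℂ (xiMap r)).im := by simpa [him] using hs
  have hxre : 0 ≤ (xiMap r).re := by
    have : (xiMap r).re = 2 * r / (1 + r ^ 2) := by
      rw [xiMap_eq, add_re, ofReal_re, re_ofReal_mul, I_re]
      ring
    rw [this]
    positivity
  have huv : arg ((t : ℂ) + xiMap r) ≤ arg ((t : ℂ) - starRingEnd ℂ (xiMap r)) :=
    arg_le_arg_of_im_eq hu (by simp) (by
      simp only [sub_re, add_re, conj_re]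
      linarith)
  have hw : 0 < (1 + I * r : ℂ).re := by simp
  have hv0 : (t : ℂ) - starRingEnd ℂ (xiMap r) ≠ 0 := fun h => by simp [h] at hv
  have key : arg (1 - I * r * z) + arg (1 - I * r * z⁻¹)
      = 2 * arg (1 + I * r) + arg (t + xiMap r) - arg (t - starRingEnd ℂ (xiMap r)) := by
    refine arg_add_arg_eq_of_mul_eq (a := 1 + t ^ 2)
      (b := normSq (t - starRingEnd ℂ (xiMap r))) (by positivity) (normSq_pos.2 hv0)
      hp hq hw (by simpa using hr0) hu hv huv ?_
    have hr1' : (1 + I * r : ℂ) ≠ 0 := fun h => by simpa using congrArg re h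
    have e1 : ((1 + t ^ 2 : ℝ) : ℂ) * ((1 - I * r * z) * (1 - I * r * z⁻¹))
        = (1 + I * r) ^ 2 * t ^ 2 + (1 - I * r) ^ 2 := by
      have e : (1 + t ^ 2 : ℂ) = (1 + I * t) * (1 - I * t) := by
        linear_combination (t ^ 2 : ℂ) * I_sq
      push_cast
      rw [e, hz]
      field_simp
      ring_nf
      simp only [I_sq, I_pow_three, I_pow_four]
      ring
    have e2 : (1 + I * r) ^ 2 * (((t : ℂ) + xiMap r) * (t - xiMap r))
        = (1 + I * r) ^ 2 * t ^ 2 + (1 - I * r) ^ 2 := by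
      rw [xiMap]
      field_simp
      linear_combination (-(1 - I * (r : ℂ)) ^ 2) * I_sq
    rw [← mul_conj, hvc]
    linear_combination (t - starRingEnd ℂ (xiMap r)) * (e1 - e2)
  have h1 := log_sub_log_conj (Or.inl hp)
  have h2 := log_sub_log_conj (Or.inl hq)
  have h3 := log_div_conj hw
  have h4 := log_sub_log_conj (Or.inr hu.ne')
  have h5 := log_sub_log_conj (Or.inr hv.ne')
  rw [hpc] at h1
  rw [hqc] at h2
  rw [hwc] at h3
  rw [huc] at h4
  rw [hvc] at h5
  have key' := congrArg (fun x : ℝ => (x : ℂ)) key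
  push_cast at key'
  rw [phiReg, sigmaReg, ← exp_add]
  congr 1
  linear_combination α * h1 + α * h2 - 2 * α * h3 - α * h4 + α * h5 + 2 * α * I * key'
end

section
/- Let α ∈ ℂ with |Re α| < 1/2 and let r ∈ (0,1). For z on the unit circle define φ_r⁺(z) = exp(α·(Log(1−irz) − Log(1+irz))) and φ_r⁻(z) = exp(α·(Log(1−irz⁻¹) − Log(1+irz⁻¹))) (each argument has positive real part, so the principal logarithms are well defined). Then for every integer m ≥ 0, (1/2πi)·∮_{|z|=1} (φ_r⁺(z)/φ_r⁻(z)) · z^m dz = i^{m+1} · (sin(πα)/π) · ∫_{−r}^{r} ((1+rx)(r+x)/((1−rx)(r−x)))^α · x^m dx, where the contour integral is (1/2π)∫₀^{2π} (φ_r⁺/φ_r⁻)(e^{iθ}) e^{i(m+1)θ} dθ and, for x ∈ (−r,r), (1+rx)(r+x)/((1−rx)(r−x)) is a positive real number with t^α := exp(α·ln t) for t > 0. (This identity results from the substitution z → iz and deforming the contour to the cut segment [−r, r] described back and forth.) -/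
open Complex Real

/-- The Toeplitz plus factor `φ_r⁺(z) = exp(α(Log(1−irz) − Log(1+irz)))`. -/
noncomputable def phiRegPlus (α : ℂ) (r : ℝ) (z : ℂ) : ℂ :=
  Complex.exp (α * (Complex.log (1 - Complex.I * r * z) - Complex.log (1 + Complex.I * r * z)))

/-- The Toeplitz minus factor `φ_r⁻(z) = exp(α(Log(1−irz⁻¹) − Log(1+irz⁻¹)))`. -/
noncomputable def phiRegMinus (α : ℂ) (r : ℝ) (z : ℂ) : ℂ :=
  Complex.exp (α * (Complex.log (1 - Complex.I * r * z⁻¹) - Complex.log (1 + Complex.I * r * z⁻¹)))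

/-- The Cayley power `((1+u)/(1-u))^α`, written with principal logarithms. -/
noncomputable def cayleyPow (α u : ℂ) : ℂ :=
  Complex.exp (α * (Complex.log (1 + u) - Complex.log (1 - u)))

/-- The Taylor coefficients at `0` of `cayleyPow α`. -/
noncomputable def cayleyCoeff (α : ℂ) (n : ℕ) : ℂ :=
  (n.factorial : ℂ)⁻¹ * iteratedDeriv n (cayleyPow α) 0

/-- The moment `∫₀¹ t^α (1-t)^(-α) (2t-1)^n dt`. -/
noncomputable def betaMoment (α : ℂ) (n : ℕ) : ℂ :=
  ∫ t in (0:ℝ)..1, (t:ℂ) ^ α * (1 - (t:ℂ)) ^ (-α) * (2 * (t:ℂ) - 1) ^ n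

theorem one_sub_mem_slitPlane_of_norm_lt_one {u : ℂ} (hu : ‖u‖ < 1) : 1 - u ∈ slitPlane := by
  rw [sub_eq_add_neg]
  exact Complex.mem_slitPlane_of_norm_lt_one (by rwa [norm_neg])

theorem hasDerivAt_cayleyPow (α : ℂ) {u : ℂ} (hu : ‖u‖ < 1) :
    HasDerivAt (cayleyPow α) (cayleyPow α u * (α * (1 / (1 + u) - -1 / (1 - u)))) u := by
  have h1 : HasDerivAt (fun v : ℂ => 1 + v) 1 u := (hasDerivAt_id u).const_add 1
  have h2 : HasDerivAt (fun v : ℂ => 1 - v) (-1) u := (hasDerivAt_id u).const_sub 1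
  exact (((h1.clog (mem_slitPlane_of_norm_lt_one hu)).sub
    (h2.clog (one_sub_mem_slitPlane_of_norm_lt_one hu))).const_mul α).cexp

theorem one_sub_sq_mul_deriv_cayleyPow (α : ℂ) {u : ℂ} (hu : ‖u‖ < 1) :
    (1 - u ^ 2) * deriv (cayleyPow α) u = 2 * α * cayleyPow α u := by
  rw [(hasDerivAt_cayleyPow α hu).deriv]
  have h1 := slitPlane_ne_zero (mem_slitPlane_of_norm_lt_one hu)
  have h2 := slitPlane_ne_zero (one_sub_mem_slitPlane_of_norm_lt_one hu)
  field_simp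
  ring

theorem differentiableOn_cayleyPow (α : ℂ) :
    DifferentiableOn ℂ (cayleyPow α) (Metric.ball 0 1) := fun _ hu =>
  (hasDerivAt_cayleyPow α (mem_ball_zero_iff.mp hu)).differentiableAt.differentiableWithinAt

theorem hasDerivAt_iteratedDeriv_cayleyPow (α : ℂ) (n : ℕ) {u : ℂ} (hu : ‖u‖ < 1) :
    HasDerivAt (iteratedDeriv n (cayleyPow α)) (iteratedDeriv (n + 1) (cayleyPow α) u) u := by
  have h : AnalyticAt ℂ (cayleyPow α) u :=
    (differentiableOn_cayleyPow α).analyticAt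
      (Metric.isOpen_ball.mem_nhds (mem_ball_zero_iff.mpr hu))
  rw [iteratedDeriv_succ, iteratedDeriv_eq_iterate]
  exact (h.iterated_deriv n).differentiableAt.hasDerivAt

theorem iteratedDeriv_cayleyPow_ode (α : ℂ) (n : ℕ) {u : ℂ} (hu : ‖u‖ < 1) :
    (1 - u ^ 2) * iteratedDeriv (n + 2) (cayleyPow α) u
        - 2 * (n + 1) * u * iteratedDeriv (n + 1) (cayleyPow α) u
        - (n + 1) * n * iteratedDeriv n (cayleyPow α) u
      = 2 * α * iteratedDeriv (n + 1) (cayleyPow α) u := by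
  induction n generalizing u with
  | zero =>
    have hq : HasDerivAt (fun v : ℂ => 1 - v ^ 2) (-(2 * u)) u := by
      simpa using (hasDerivAt_pow 2 u).const_sub 1
    have hL := hq.mul (hasDerivAt_iteratedDeriv_cayleyPow α 1 hu)
    have hR := (hasDerivAt_iteratedDeriv_cayleyPow α 0 hu).const_mul (2 * α)
    have heq : (fun v => (1 - v ^ 2) * iteratedDeriv 1 (cayleyPow α) v) =ᶠ[nhds u]
        fun v => 2 * α * iteratedDeriv 0 (cayleyPow α) v := by
      filter_upwards [Metric.isOpen_ball.mem_nhds (mem_ball_zero_iff.mpr hu)] with v hv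
      simpa [iteratedDeriv_one, iteratedDeriv_zero] using
        one_sub_sq_mul_deriv_cayleyPow α (mem_ball_zero_iff.mp hv)
    have key := hL.unique (hR.congr_of_eventuallyEq heq)
    norm_num at key ⊢
    linear_combination key
  | succ n ih =>
    have hq : HasDerivAt (fun v : ℂ => 1 - v ^ 2) (-(2 * u)) u := by
      simpa using (hasDerivAt_pow 2 u).const_sub 1
    have hl : HasDerivAt (fun v : ℂ => 2 * ((n:ℂ) + 1) * v) (2 * ((n:ℂ) + 1)) u := by
      simpa using (hasDerivAt_id u).const_mul (2 * ((n:ℂ) + 1))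
    have hL := ((hq.mul (hasDerivAt_iteratedDeriv_cayleyPow α (n + 2) hu)).sub
      (hl.mul (hasDerivAt_iteratedDeriv_cayleyPow α (n + 1) hu))).sub
      ((hasDerivAt_iteratedDeriv_cayleyPow α n hu).const_mul (((n:ℂ) + 1) * n))
    have hR := (hasDerivAt_iteratedDeriv_cayleyPow α (n + 1) hu).const_mul (2 * α)
    have heq : (fun v => (1 - v ^ 2) * iteratedDeriv (n + 2) (cayleyPow α) v
        - 2 * ((n:ℂ) + 1) * v * iteratedDeriv (n + 1) (cayleyPow α) v
        - ((n:ℂ) + 1) * n * iteratedDeriv n (cayleyPow α) v) =ᶠ[nhds u]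
        fun v => 2 * α * iteratedDeriv (n + 1) (cayleyPow α) v := by
      filter_upwards [Metric.isOpen_ball.mem_nhds (mem_ball_zero_iff.mpr hu)] with v hv
      exact ih (mem_ball_zero_iff.mp hv)
    have key := hL.unique (hR.congr_of_eventuallyEq heq)
    push_cast
    linear_combination key

theorem cayleyCoeff_zero (α : ℂ) : cayleyCoeff α 0 = 1 := by
  simp [cayleyCoeff, cayleyPow]

theorem cayleyCoeff_one (α : ℂ) : cayleyCoeff α 1 = 2 * α := by
  have h := one_sub_sq_mul_deriv_cayleyPow α (u := 0) (by simp)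
  simpa [cayleyCoeff, iteratedDeriv_one, cayleyPow] using h

theorem cayleyCoeff_recurrence (α : ℂ) (n : ℕ) :
    (n + 2) * cayleyCoeff α (n + 2) = n * cayleyCoeff α n + 2 * α * cayleyCoeff α (n + 1) := by
  have h := iteratedDeriv_cayleyPow_ode α n (u := 0) (by simp)
  have hf : (n.factorial : ℂ) ≠ 0 := by exact_mod_cast n.factorial_ne_zero
  have h1 : ((n:ℂ) + 1) ≠ 0 := by exact_mod_cast n.succ_ne_zero
  have h2 : ((n:ℂ) + 2) ≠ 0 := by exact_mod_cast (n + 1).succ_ne_zero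
  simp only [cayleyCoeff, Nat.factorial_succ]
  push_cast
  have h3 : ((n:ℂ) + 1 + 1) ≠ 0 := by convert h2 using 1; ring
  field_simp
  linear_combination ((n:ℂ) + 2) * h

theorem hasSum_cayleyPow (α : ℂ) {u : ℂ} (hu : ‖u‖ < 1) :
    HasSum (fun n => cayleyCoeff α n * u ^ n) (cayleyPow α u) := by
  have h := Complex.hasSum_taylorSeries_on_ball (differentiableOn_cayleyPow α)
    (mem_ball_zero_iff.mpr hu)
  convert! h using 2 with n
  simp only [cayleyCoeff, smul_eq_mul, sub_zero]
  ring

theorem re_one_add_pos {α : ℂ} (hα : |α.re| < 1 / 2) : 0 < (1 + α).re := by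
  rw [add_re, one_re]; linarith [(abs_lt.mp hα).1]

theorem re_one_sub_pos {α : ℂ} (hα : |α.re| < 1 / 2) : 0 < (1 - α).re := by
  rw [sub_re, one_re]; linarith [(abs_lt.mp hα).2]

theorem intervalIntegrable_betaWeight {α : ℂ} (hα : |α.re| < 1 / 2) (n : ℕ) :
    IntervalIntegrable (fun t : ℝ => (t:ℂ) ^ α * (1 - (t:ℂ)) ^ (-α) * (2 * (t:ℂ) - 1) ^ n)
      MeasureTheory.volume 0 1 := by
  have h := betaIntegral_convergent (re_one_add_pos hα) (re_one_sub_pos hα)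
  rw [add_sub_cancel_left, show (1:ℂ) - α - 1 = -α by ring] at h
  exact h.mul_continuousOn (by fun_prop)

theorem betaMoment_zero {α : ℂ} (hα : |α.re| < 1 / 2) :
    Complex.sin (π * α) * betaMoment α 0 = π * α := by
  have h := Gamma_mul_Gamma_eq_betaIntegral (re_one_add_pos hα) (re_one_sub_pos hα)
  have hB : betaIntegral (1 + α) (1 - α) = betaMoment α 0 := by
    simp only [betaIntegral, betaMoment, add_sub_cancel_left, pow_zero, mul_one,
      show (1:ℂ) - α - 1 = -α by ring]
  rw [hB, show (1 + α) + (1 - α) = 1 + 1 by ring, Gamma_add_one 1 one_ne_zero,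
    Complex.Gamma_one, one_mul, one_mul] at h
  rcases eq_or_ne α 0 with rfl | h0
  · simp
  have hne : Complex.Gamma (1 + α) * Complex.Gamma (1 - α) ≠ 0 :=
    mul_ne_zero (Gamma_ne_zero_of_re_pos (re_one_add_pos hα))
      (Gamma_ne_zero_of_re_pos (re_one_sub_pos hα))
  rw [add_comm 1 α, Gamma_add_one α h0, mul_assoc, Complex.Gamma_mul_Gamma_one_sub] at h hne
  have hs : Complex.sin (π * α) ≠ 0 := by
    intro hs
    simp [hs] at hne
  rw [← h]
  field_simp

theorem betaMoment_recurrence {α : ℂ} (hα : |α.re| < 1 / 2) (n : ℕ) :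
    (n + 2) * betaMoment α (n + 1) = n * betaMoment α (n - 1) + 2 * α * betaMoment α n := by
  have hu := re_one_add_pos hα
  have hv := re_one_sub_pos hα
  let F : ℝ → ℂ := fun t => (t:ℂ) ^ (1 + α) * (1 - (t:ℂ)) ^ (1 - α) * (2 * (t:ℂ) - 1) ^ n
  have hc : ContinuousOn F (Set.Icc 0 1) := by
    refine ContinuousOn.mul ((continuousOn_of_forall_continuousAt fun x hx => ?_).mul
        (continuousOn_of_forall_continuousAt fun x hx => ?_)) (by fun_prop)
    · refine (continuousAt_cpow_const_of_re_pos (Or.inl ?_) hu).comp continuous_ofReal.continuousAt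
      rw [ofReal_re]; exact hx.1
    · refine (continuousAt_cpow_const_of_re_pos (Or.inl ?_) hv).comp (by fun_prop)
      rw [sub_re, one_re, ofReal_re, sub_nonneg]
      exact hx.2
  let w : ℕ → ℝ → ℂ := fun k t => (t:ℂ) ^ α * (1 - (t:ℂ)) ^ (-α) * (2 * (t:ℂ) - 1) ^ k
  have hw : ∀ k, IntervalIntegrable (w k) MeasureTheory.volume 0 1 :=
    intervalIntegrable_betaWeight hα
  have hder : ∀ t ∈ Set.Ioo (0:ℝ) 1, HasDerivAt F
      (α * w n t + n / 2 * w (n - 1) t - (n + 2) / 2 * w (n + 1) t) t := by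
    intro t ht
    have ht0 : (t:ℂ) ∈ slitPlane := Or.inl (by simpa using ht.1)
    have ht1 : 1 - (t:ℂ) ∈ slitPlane := Or.inl (by simpa using ht.2)
    have U : HasDerivAt (fun z : ℂ => z ^ (1 + α)) ((1 + α) * (t:ℂ) ^ α) t := by
      simpa using (hasDerivAt_id (t:ℂ)).cpow_const (c := 1 + α) ht0
    have V : HasDerivAt (fun z : ℂ => (1 - z) ^ (1 - α)) (-((1 - α) * (1 - (t:ℂ)) ^ (-α))) t := by
      have := ((hasDerivAt_id (t:ℂ)).const_sub 1).cpow_const (c := 1 - α) ht1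
      simpa [show (1:ℂ) - α - 1 = -α by ring] using this
    have P : HasDerivAt (fun z : ℂ => (2 * z - 1) ^ n) (n * (2 * (t:ℂ) - 1) ^ (n - 1) * 2) t := by
      have := (((hasDerivAt_id (t:ℂ)).const_mul 2).sub_const 1).fun_pow n
      simpa using this
    have e1 : (t:ℂ) ^ (1 + α) = t * (t:ℂ) ^ α := by
      rw [cpow_add _ _ (slitPlane_ne_zero ht0), cpow_one]
    have e2 : (1 - (t:ℂ)) ^ (1 - α) = (1 - t) * (1 - (t:ℂ)) ^ (-α) := by
      rw [sub_eq_add_neg 1 α, cpow_add _ _ (slitPlane_ne_zero ht1), cpow_one]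
    convert! ((U.mul V).mul P).comp_ofReal using 1
    simp only [w, Pi.mul_apply, e1, e2]
    rcases n with _ | n
    · simp
      ring
    · simp only [Nat.add_sub_cancel, pow_succ]
      push_cast
      ring
  have hint := (((hw n).const_mul α).add ((hw (n - 1)).const_mul (n / 2 : ℂ))).sub
    ((hw (n + 1)).const_mul ((n + 2) / 2 : ℂ))
  have key := intervalIntegral.integral_eq_sub_of_hasDerivAt_of_le zero_le_one hc hder hint
  have h0 : (1 + α) ≠ 0 := fun h => by simp [h] at hu
  have h1 : (1 - α) ≠ 0 := fun h => by simp [h] at hv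
  have hF0 : F 0 = 0 := by simp [F, zero_cpow h0]
  have hF1 : F 1 = 0 := by simp [F, zero_cpow h1]
  rw [hF0, hF1, intervalIntegral.integral_sub (((hw n).const_mul α).add
      ((hw (n - 1)).const_mul (n / 2 : ℂ))) ((hw (n + 1)).const_mul ((n + 2) / 2 : ℂ)),
    intervalIntegral.integral_add ((hw n).const_mul α) ((hw (n - 1)).const_mul (n / 2 : ℂ)),
    intervalIntegral.integral_const_mul, intervalIntegral.integral_const_mul,
    intervalIntegral.integral_const_mul] at key
  change α * betaMoment α n + n / 2 * betaMoment α (n - 1)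
    - (n + 2) / 2 * betaMoment α (n + 1) = 0 - 0 at key
  linear_combination (-2) * key

theorem cayleyCoeff_succ_eq_betaMoment {α : ℂ} (hα : |α.re| < 1 / 2) (n : ℕ) :
    cayleyCoeff α (n + 1) = 2 * (Complex.sin (π * α) / π) * betaMoment α n := by
  have hπ : (π:ℂ) ≠ 0 := by exact_mod_cast Real.pi_ne_zero
  have h0 : cayleyCoeff α 1 = 2 * (Complex.sin (π * α) / π) * betaMoment α 0 := by
    rw [cayleyCoeff_one]
    rw [mul_assoc, div_mul_eq_mul_div, betaMoment_zero hα, mul_div_cancel_left₀ _ hπ]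
  induction n using Nat.twoStepInduction with
  | zero => exact h0
  | one =>
    have h1 := cayleyCoeff_recurrence α 0
    have h2 := betaMoment_recurrence hα 0
    norm_num at h1 h2 ⊢
    rw [h0] at h1
    linear_combination (1 / 2) * h1 - (Complex.sin (π * α) / π) * h2
  | more n ih ih' =>
    have h1 := cayleyCoeff_recurrence α (n + 1)
    have h2 := betaMoment_recurrence hα (n + 1)
    rw [Nat.add_sub_cancel] at h2
    push_cast at h1 h2
    have h3 : ((n:ℂ) + 1 + 2) ≠ 0 := by exact_mod_cast (n + 2).succ_ne_zero
    refine mul_left_cancel₀ h3 ?_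
    rw [ih, show n + 1 + 1 = n + 2 by ring] at h1
    rw [show n + 1 + 1 = n + 2 by ring] at ih' h2
    rw [ih'] at h1
    linear_combination h1 - 2 * (Complex.sin (π * α) / π) * h2

/-- Termwise integration of a power series against an integrable weight. -/
theorem hasSum_integral_mul_of_summable_norm {a b : ℝ} {w p G : ℝ → ℂ} {c : ℕ → ℂ}
    (hw : IntervalIntegrable w MeasureTheory.volume a b) (hp : Continuous p)
    (hp1 : ∀ t ∈ Set.uIoc a b, ‖p t‖ ≤ 1) (hc : Summable fun n => ‖c n‖)
    (hG : ∀ t ∈ Set.uIoc a b, HasSum (fun n => c n * p t ^ n) (G t)) :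
    HasSum (fun n => c n * ∫ t in a..b, w t * p t ^ n) (∫ t in a..b, w t * G t) := by
  have h := intervalIntegral.hasSum_integral_of_dominated_convergence
    (μ := MeasureTheory.volume) (a := a) (b := b)
    (F := fun n t => c n * (w t * p t ^ n)) (f := fun t => w t * G t)
    (fun n t => ‖c n‖ * ‖w t‖) (fun n => ?_) ?_ ?_ ?_ ?_
  · simpa only [intervalIntegral.integral_const_mul] using h
  · exact (hw.aestronglyMeasurable_restrict_uIoc.mul
      (hp.pow n).aestronglyMeasurable).const_mul (c n)
  · refine fun n => Filter.Eventually.of_forall fun t ht => ?_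
    rw [norm_mul, norm_mul, norm_pow]
    gcongr
    exact mul_le_of_le_one_right (norm_nonneg _) (pow_le_one₀ (norm_nonneg _) (hp1 t ht))
  · exact Filter.Eventually.of_forall fun t _ => hc.mul_right _
  · simp only [tsum_mul_right]
    exact hw.norm.const_mul _
  · refine Filter.Eventually.of_forall fun t ht => ?_
    simpa only [mul_left_comm (w t)] using (hG t ht).mul_left (w t)

theorem integral_exp_int_mul_I (k : ℤ) :
    ∫ θ in (0:ℝ)..(2 * π), Complex.exp (Complex.I * k * θ) = if k = 0 then 2 * (π:ℂ) else 0 := by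
  split_ifs with hk
  · simp [hk]
  · have hk' : Complex.I * (k:ℂ) ≠ 0 := mul_ne_zero I_ne_zero (by exact_mod_cast hk)
    rw [integral_exp_mul_complex hk']
    have : Complex.I * (k:ℂ) * ((2 * π : ℝ) : ℂ) = k * (2 * π * Complex.I) := by push_cast; ring
    rw [this, exp_int_mul_two_pi_mul_I]
    simp

theorem summable_norm_cayleyCoeff (α : ℂ) {b : ℂ} (hb : ‖b‖ < 1) :
    Summable fun n => ‖cayleyCoeff α n * b ^ n‖ :=
  (hasSum_cayleyPow α hb).summable.norm

/-- The Fourier coefficients of `θ ↦ cayleyPow α (b e^{-iθ})`. -/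
theorem integral_cayleyPow_mul_exp (α : ℂ) {b : ℂ} (hb : ‖b‖ < 1) (k : ℕ) :
    ∫ θ in (0:ℝ)..(2 * π), cayleyPow α (b * (Complex.exp (Complex.I * θ))⁻¹)
        * Complex.exp (Complex.I * θ) ^ k
      = 2 * π * (cayleyCoeff α k * b ^ k) := by
  have h := hasSum_integral_mul_of_summable_norm (a := 0) (b := 2 * π)
    (w := fun θ => Complex.exp (Complex.I * θ) ^ k)
    (p := fun θ => (Complex.exp (Complex.I * θ))⁻¹)
    (G := fun θ => cayleyPow α (b * (Complex.exp (Complex.I * θ))⁻¹))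
    (c := fun n => cayleyCoeff α n * b ^ n)
    (Continuous.intervalIntegrable (by fun_prop) _ _)
    (by simp only [← Complex.exp_neg]; fun_prop)
    (fun t _ => by simp [mul_comm Complex.I, norm_exp_ofReal_mul_I])
    (summable_norm_cayleyCoeff α hb)
    (fun t _ => by
      have hn : ‖b * (Complex.exp (Complex.I * t))⁻¹‖ < 1 := by
        simpa [mul_comm Complex.I, norm_exp_ofReal_mul_I] using hb
      simpa only [mul_pow, mul_assoc] using hasSum_cayleyPow α hn)
  have hterm : ∀ n : ℕ, ∫ θ in (0:ℝ)..(2 * π), Complex.exp (Complex.I * θ) ^ k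
      * (Complex.exp (Complex.I * θ))⁻¹ ^ n = if n = k then 2 * (π:ℂ) else 0 := by
    intro n
    have := integral_exp_int_mul_I ((k:ℤ) - n)
    simp only [show ((k:ℤ) - n = 0) ↔ n = k by omega] at this
    rw [← this]
    congr 1
    ext θ
    rw [← Complex.exp_neg, ← Complex.exp_nat_mul, ← Complex.exp_nat_mul, ← Complex.exp_add]
    congr 1
    push_cast
    ring
  simp only [hterm] at h
  have h' := h.unique (hasSum_single k fun n hn => by simp [hn])
  simp only [if_true] at h'
  rw [mul_comm (2 * (π:ℂ)), ← h']
  congr 1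
  ext θ
  ring

theorem phiRegPlus_eq_cayleyPow (α : ℂ) (r : ℝ) (z : ℂ) :
    phiRegPlus α r z = cayleyPow α (-(Complex.I * r) * z) := by
  simp only [phiRegPlus, cayleyPow]
  congr 4 <;> ring

theorem inv_phiRegMinus_eq_cayleyPow (α : ℂ) (r : ℝ) (z : ℂ) :
    (phiRegMinus α r z)⁻¹ = cayleyPow α (Complex.I * r * z⁻¹) := by
  simp only [phiRegMinus, cayleyPow, ← Complex.exp_neg]
  congr 1
  ring

theorem continuous_cayleyPow_mul_inv_exp (α : ℂ) {b : ℂ} (hb : ‖b‖ < 1) :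
    Continuous fun θ : ℝ => cayleyPow α (b * (Complex.exp (Complex.I * θ))⁻¹) := by
  refine (differentiableOn_cayleyPow α).continuousOn.comp_continuous
    (by simp only [← Complex.exp_neg]; fun_prop) fun θ => ?_
  simpa [mul_comm Complex.I, norm_exp_ofReal_mul_I] using hb

/-- The contour integral expanded in the Taylor coefficients. -/
theorem hasSum_contour_phiReg (α : ℂ) {r : ℝ} (hr0 : 0 < r) (hr1 : r < 1) (m : ℕ) :
    HasSum (fun j => Complex.I ^ (m + 1) * (cayleyCoeff α j * cayleyCoeff α (j + m + 1)
        * (r:ℂ) ^ (2 * j + m + 1)))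
      ((1 / (2 * (π:ℂ))) *
        ∫ θ in (0:ℝ)..(2 * π),
          (phiRegPlus α r (Complex.exp (Complex.I * θ)) /
            phiRegMinus α r (Complex.exp (Complex.I * θ)))
            * Complex.exp (Complex.I * (m + 1) * θ)) := by
  have hπ : (π:ℂ) ≠ 0 := by exact_mod_cast Real.pi_ne_zero
  have hb : ‖Complex.I * (r:ℂ)‖ < 1 := by simpa [abs_of_pos hr0] using hr1
  have hb' : ‖-(Complex.I * (r:ℂ))‖ < 1 := by rwa [norm_neg]
  have h := hasSum_integral_mul_of_summable_norm (a := 0) (b := 2 * π)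
    (w := fun θ => cayleyPow α (Complex.I * r * (Complex.exp (Complex.I * θ))⁻¹)
      * Complex.exp (Complex.I * θ) ^ (m + 1))
    (p := fun θ => Complex.exp (Complex.I * θ))
    (G := fun θ => cayleyPow α (-(Complex.I * r) * Complex.exp (Complex.I * θ)))
    (c := fun n => cayleyCoeff α n * (-(Complex.I * r)) ^ n)
    (((continuous_cayleyPow_mul_inv_exp α hb).mul (by fun_prop)).intervalIntegrable _ _)
    (by fun_prop)
    (fun t _ => by simp [mul_comm Complex.I, norm_exp_ofReal_mul_I])
    (summable_norm_cayleyCoeff α hb')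
    (fun t _ => by
      have hn : ‖-(Complex.I * (r:ℂ)) * Complex.exp (Complex.I * t)‖ < 1 := by
        rw [norm_mul, mul_comm Complex.I (t:ℂ), norm_exp_ofReal_mul_I, mul_one]
        exact hb'
      simpa only [mul_pow, mul_assoc] using hasSum_cayleyPow α hn)
  simp only [mul_assoc _ (Complex.exp _ ^ _) (Complex.exp _ ^ _), ← pow_add] at h
  simp only [integral_cayleyPow_mul_exp α hb] at h
  convert! h.mul_left (1 / (2 * (π:ℂ))) using 1
  · ext j
    have hI : (-(Complex.I * (r:ℂ))) ^ j * (Complex.I * r) ^ (m + 1 + j)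
        = Complex.I ^ (m + 1) * (r:ℂ) ^ (2 * j + m + 1) := by
      rw [pow_add (Complex.I * (r:ℂ)), mul_left_comm, ← mul_pow,
        show -(Complex.I * (r:ℂ)) * (Complex.I * r) = (r:ℂ) ^ 2 by
          linear_combination (-(r:ℂ) ^ 2) * I_mul_I]
      ring
    rw [show j + m + 1 = m + 1 + j by ring]
    field_simp
    linear_combination (-cayleyCoeff α j * cayleyCoeff α (m + 1 + j)) * hI
  · congr 2
    ext θ
    rw [div_eq_mul_inv, phiRegPlus_eq_cayleyPow, inv_phiRegMinus_eq_cayleyPow,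
      ← Complex.exp_nat_mul]
    push_cast
    rw [show Complex.I * ((m:ℂ) + 1) * θ = ((m:ℂ) + 1) * (Complex.I * θ) by ring]
    ring

/-- The real integrand after the substitution `x = r(2t-1)`. -/
theorem exp_log_segment_eq (α : ℂ) {r t : ℝ} (hr0 : 0 < r) (hr1 : r < 1) (ht0 : 0 < t)
    (ht1 : t < 1) :
    Complex.exp (α * Real.log ((1 + r * (2 * r * t - r)) * (r + (2 * r * t - r)) /
        ((1 - r * (2 * r * t - r)) * (r - (2 * r * t - r)))))
      = (t:ℂ) ^ α * (1 - (t:ℂ)) ^ (-α) * cayleyPow α ((r:ℂ) ^ 2 * (2 * t - 1)) := by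
  have hy : |r ^ 2 * (2 * t - 1)| < 1 := by
    rw [abs_lt]; constructor <;> nlinarith
  obtain ⟨hy0, hy1⟩ := abs_lt.mp hy
  have hp : 0 < 1 + r ^ 2 * (2 * t - 1) := by linarith
  have hm : 0 < 1 - r ^ 2 * (2 * t - 1) := by linarith
  have ht1' : 0 < 1 - t := by linarith
  have e : (1 + r * (2 * r * t - r)) * (r + (2 * r * t - r)) /
        ((1 - r * (2 * r * t - r)) * (r - (2 * r * t - r)))
      = (t * (1 + r ^ 2 * (2 * t - 1))) / ((1 - t) * (1 - r ^ 2 * (2 * t - 1))) := by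
    rw [show (1 + r * (2 * r * t - r)) * (r + (2 * r * t - r))
        = (t * (1 + r ^ 2 * (2 * t - 1))) * (2 * r) by ring,
      show (1 - r * (2 * r * t - r)) * (r - (2 * r * t - r))
        = ((1 - t) * (1 - r ^ 2 * (2 * t - 1))) * (2 * r) by ring,
      mul_div_mul_right _ _ (by positivity)]
  rw [e, Real.log_div (by positivity) (by positivity), Real.log_mul ht0.ne' hp.ne',
    Real.log_mul ht1'.ne' hm.ne', cpow_def_of_ne_zero (by exact_mod_cast ht0.ne'),
    cpow_def_of_ne_zero (by exact_mod_cast ht1'.ne'), cayleyPow, ← Complex.exp_add,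
    ← Complex.exp_add]
  push_cast [Complex.ofReal_log ht0.le, Complex.ofReal_log ht1'.le, Complex.ofReal_log hp.le,
    Complex.ofReal_log hm.le]
  congr 1
  ring

/-- The segment integral expanded in the Taylor coefficients. -/
theorem hasSum_segment_integral {α : ℂ} (hα : |α.re| < 1 / 2) {r : ℝ} (hr0 : 0 < r) (hr1 : r < 1)
    (m : ℕ) :
    HasSum (fun j => cayleyCoeff α j * betaMoment α (j + m) * (2 * (r:ℂ) ^ (2 * j + m + 1)))
      (∫ x in (-r)..r,
        Complex.exp (α * Real.log ((1 + r * x) * (r + x) / ((1 - r * x) * (r - x))))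
          * (x:ℂ) ^ m) := by
  have hb : ‖(r:ℂ) ^ 2‖ < 1 := by
    rw [norm_pow, norm_real, norm_of_nonneg hr0.le]
    nlinarith
  have habs : ∀ t ∈ Set.uIoc (0:ℝ) 1, ‖2 * (t:ℂ) - 1‖ ≤ 1 := by
    intro t ht
    rw [Set.uIoc_of_le zero_le_one] at ht
    have : (2 * (t:ℂ) - 1) = ((2 * t - 1 : ℝ) : ℂ) := by push_cast; ring
    rw [this, norm_real, Real.norm_eq_abs, abs_le]
    constructor <;> linarith [ht.1, ht.2]
  have h := hasSum_integral_mul_of_summable_norm (a := 0) (b := 1)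
    (w := fun t => (t:ℂ) ^ α * (1 - (t:ℂ)) ^ (-α) * (2 * (t:ℂ) - 1) ^ m)
    (p := fun t => 2 * (t:ℂ) - 1)
    (G := fun t => cayleyPow α ((r:ℂ) ^ 2 * (2 * t - 1)))
    (c := fun n => cayleyCoeff α n * ((r:ℂ) ^ 2) ^ n)
    (intervalIntegrable_betaWeight hα m) (by fun_prop) habs (summable_norm_cayleyCoeff α hb)
    (fun t ht => by
      have hn : ‖(r:ℂ) ^ 2 * (2 * (t:ℂ) - 1)‖ < 1 := by
        rw [norm_mul]
        exact (mul_le_of_le_one_right (norm_nonneg _) (habs t ht)).trans_lt hb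
      simpa only [mul_pow, mul_assoc] using hasSum_cayleyPow α hn)
  simp only [mul_assoc _ ((2 * (_:ℂ) - 1) ^ _) ((2 * (_:ℂ) - 1) ^ _), ← pow_add] at h
  change HasSum (fun n => cayleyCoeff α n * ((r:ℂ) ^ 2) ^ n * betaMoment α (m + n)) _ at h
  convert! h.mul_left (2 * (r:ℂ) ^ (m + 1)) using 1
  · ext j
    rw [add_comm j m]
    ring
  · have hs := intervalIntegral.smul_integral_comp_mul_sub (a := 0) (b := 1)
      (fun x : ℝ => Complex.exp (α * Real.log ((1 + r * x) * (r + x) /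
        ((1 - r * x) * (r - x)))) * (x:ℂ) ^ m) (2 * r) r
    rw [show 2 * r * 0 - r = -r by ring, show 2 * r * 1 - r = r by ring] at hs
    rw [← hs, real_smul, ← intervalIntegral.integral_const_mul,
      ← intervalIntegral.integral_const_mul]
    refine intervalIntegral.integral_congr_Ioo_of_le zero_le_one fun t ht => ?_
    rw [exp_log_segment_eq α hr0 hr1 ht.1 ht.2]
    push_cast
    rw [show (2 * (r:ℂ) * t - r) = r * (2 * t - 1) by ring, mul_pow]
    ring

/-- **Contour deformation of the moments of `φ_r⁺/φ_r⁻`.**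
For `|Re α| < 1/2`, `r ∈ (0,1)` and every integer `m ≥ 0`,
`(1/2πi)∮_{|z|=1} (φ_r⁺(z)/φ_r⁻(z)) z^m dz
  = i^{m+1} (sin πα / π) ∫_{−r}^{r} ((1+rx)(r+x)/((1−rx)(r−x)))^α x^m dx`,
the contour integral being `(1/2π)∫₀^{2π} (φ_r⁺/φ_r⁻)(e^{iθ}) e^{i(m+1)θ} dθ`; moreover
`(1+rx)(r+x)/((1−rx)(r−x)) > 0` for `x ∈ (−r,r)`. -/
theorem phiReg_moment_contour_deformation
    (α : ℂ) (hα : |α.re| < 1 / 2) (r : ℝ) (hr0 : 0 < r) (hr1 : r < 1) (m : ℕ) :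
    (∀ x ∈ Set.Ioo (-r) r, 0 < (1 + r * x) * (r + x) / ((1 - r * x) * (r - x))) ∧
    (1 / (2 * (π:ℂ))) *
        ∫ θ in (0:ℝ)..(2 * π),
          (phiRegPlus α r (Complex.exp (Complex.I * θ)) /
            phiRegMinus α r (Complex.exp (Complex.I * θ)))
            * Complex.exp (Complex.I * (m + 1) * θ)
      = Complex.I ^ (m + 1) * (Complex.sin ((π:ℂ) * α) / (π:ℂ)) *
          ∫ x in (-r)..r,
            Complex.exp (α * Real.log ((1 + r * x) * (r + x) / ((1 - r * x) * (r - x))))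
              * (x:ℂ) ^ m := by
  refine ⟨fun x hx => ?_, ?_⟩
  · have h1 : 0 < r + x := by linarith [hx.1]
    have h2 : 0 < r - x := by linarith [hx.2]
    have h3 : 0 < 1 + r * x := by nlinarith
    have h4 : 0 < 1 - r * x := by nlinarith
    positivity
  · refine (hasSum_contour_phiReg α hr0 hr1 m).unique ?_
    convert! (hasSum_segment_integral hα hr0 hr1 m).mul_left
      (Complex.I ^ (m + 1) * (Complex.sin ((π:ℂ) * α) / (π:ℂ))) using 1
    ext j
    rw [cayleyCoeff_succ_eq_betaMoment hα (j + m)]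
    ring
end

section
/- Define ξ(x) = i(1−ix)/(1+ix), so that ξ(1) = 1 and i(ξ(1−x)−1) = −x + O(x²) as x → 0⁺. There exists δ₀ ∈ (0,1) such that for every δ ∈ (0, δ₀) the following holds: if (R_n) is a sequence of positive reals with R_n − n = o(n^{1/2}) as n → ∞, then lim_{n→∞} ∫₀^{δ} x^{−3/2} · |exp(i(ξ(1−x)−1)·R_n) − (1−x)^n|² dx = 0. -/
open Complex Filter Topology Real

/-- The complex exponential is Lipschitz with constant `exp (-m)` on the half-plane `re z ≤ -m`. -/
theorem norm_cexp_sub_cexp_le_of_re_le {a b : ℂ} {m : ℝ} (ha : a.re ≤ -m) (hb : b.re ≤ -m) :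
    ‖Complex.exp a - Complex.exp b‖ ≤ Real.exp (-m) * ‖a - b‖ := by
  have hconv : Convex ℝ {z : ℂ | z.re ≤ -m} := convex_halfSpace_re_le (-m)
  refine hconv.norm_image_sub_le_of_norm_hasDerivWithin_le (f := Complex.exp)
    (f' := Complex.exp) (fun z _ => (Complex.hasDerivAt_exp z).hasDerivWithinAt) ?_ hb ha
  intro z hz
  rw [Complex.norm_exp]
  exact Real.exp_le_exp.2 hz

theorem norm_one_add_I_div_two_le : ‖(1 + Complex.I) / 2‖ ≤ 1 := by
  calc ‖(1 + Complex.I) / 2‖ = ‖1 + Complex.I‖ / 2 := by simp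
    _ ≤ (‖(1 : ℂ)‖ + ‖Complex.I‖) / 2 := by gcongr; exact norm_add_le _ _
    _ = 1 := by norm_num

theorem half_le_norm_one_sub {x : ℝ} (hx1 : x ≤ 1) :
    1 / 2 ≤ ‖1 - (x : ℂ) * ((1 + Complex.I) / 2)‖ := by
  refine le_trans ?_ (Complex.re_le_norm _)
  simp
  linarith

theorem one_sub_ne_zero_of_le_one {x : ℝ} (hx1 : x ≤ 1) :
    1 - (x : ℂ) * ((1 + Complex.I) / 2) ≠ 0 := by
  rw [← norm_pos_iff]
  linarith [half_le_norm_one_sub hx1]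

theorem I_mul_xiMap_one_sub_sub_one {x : ℝ} (hx1 : x ≤ 1) :
    Complex.I * (xiMap (1 - x) - 1) = -x / (1 - (x : ℂ) * ((1 + Complex.I) / 2)) := by
  have hd := one_sub_ne_zero_of_le_one hx1
  have hI : (1 + Complex.I) ≠ 0 := by
    intro h
    simpa using congrArg Complex.re h
  have hfac : 1 + Complex.I * ((1 - x : ℝ) : ℂ)
      = (1 + Complex.I) * (1 - (x : ℂ) * ((1 + Complex.I) / 2)) := by
    push_cast
    linear_combination ((x : ℂ) / 2) * Complex.I_sq
  have hne : 1 + Complex.I * ((1 - x : ℝ) : ℂ) ≠ 0 := by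
    rw [hfac]
    exact mul_ne_zero hI hd
  have hxi : Complex.I * (xiMap (1 - x) - 1)
      = -x * (1 + Complex.I) / (1 + Complex.I * ((1 - x : ℝ) : ℂ)) := by
    rw [xiMap, eq_div_iff hne, mul_assoc, sub_mul, div_mul_cancel₀ _ hne]
    push_cast
    linear_combination (x - Complex.I * (1 - x)) * Complex.I_sq
  rw [hxi, hfac]
  field_simp

theorem re_I_mul_xiMap_le {x : ℝ} (hx0 : 0 ≤ x) (hx1 : x ≤ 1) :
    (Complex.I * (xiMap (1 - x) - 1)).re ≤ -x := by
  have hpos : 0 < 1 - x + x ^ 2 / 2 := by nlinarith [sq_nonneg (x - 1)]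
  have hns : Complex.normSq (1 - (x : ℂ) * ((1 + Complex.I) / 2)) = 1 - x + x ^ 2 / 2 := by
    simp [Complex.normSq_apply]
    ring
  rw [I_mul_xiMap_one_sub_sub_one hx1, Complex.div_re, hns]
  simp
  rw [div_le_iff₀ hpos]
  nlinarith [mul_nonneg hx0 (mul_nonneg hx0 (sub_nonneg.2 hx1))]

theorem norm_I_mul_xiMap_le {x : ℝ} (hx0 : 0 ≤ x) (hx1 : x ≤ 1) :
    ‖Complex.I * (xiMap (1 - x) - 1)‖ ≤ 2 * x := by
  have hd := half_le_norm_one_sub hx1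
  rw [I_mul_xiMap_one_sub_sub_one hx1, norm_div, norm_neg, Complex.norm_real,
    Real.norm_of_nonneg hx0, div_le_iff₀ (by linarith)]
  nlinarith

theorem norm_I_mul_xiMap_add_le {x : ℝ} (hx0 : 0 ≤ x) (hx1 : x ≤ 1) :
    ‖Complex.I * (xiMap (1 - x) - 1) + x‖ ≤ 2 * x ^ 2 := by
  have hd := half_le_norm_one_sub hx1
  have hne := one_sub_ne_zero_of_le_one hx1
  have h : Complex.I * (xiMap (1 - x) - 1) + x
      = -((x : ℂ) ^ 2 * ((1 + Complex.I) / 2)) / (1 - (x : ℂ) * ((1 + Complex.I) / 2)) := by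
    rw [I_mul_xiMap_one_sub_sub_one hx1, eq_div_iff hne, add_mul, div_mul_cancel₀ _ hne]
    ring
  rw [h, norm_div, norm_neg, norm_mul, norm_pow, Complex.norm_real, Real.norm_of_nonneg hx0,
    div_le_iff₀ (by linarith)]
  nlinarith [norm_one_add_I_div_two_le, sq_nonneg x,
    mul_le_mul_of_nonneg_left norm_one_add_I_div_two_le (sq_nonneg x),
    mul_le_mul_of_nonneg_left hd (sq_nonneg x)]

theorem abs_log_one_sub_add_le {x : ℝ} (hx1 : x ≤ 1 / 2) :
    |Real.log (1 - x) + x| ≤ 2 * x ^ 2 := by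
  have hpos : 0 < 1 - x := by linarith
  have hlow := Real.one_sub_inv_le_log_of_pos hpos
  have hup := Real.log_le_sub_one_of_pos hpos
  have hinv : (1 - x)⁻¹ ≤ 1 + x + 2 * x ^ 2 := by
    rw [inv_le_iff_one_le_mul₀ hpos]
    nlinarith [mul_nonneg (sq_nonneg x) (by linarith : 0 ≤ 1 - 2 * x)]
  rw [abs_le]
  constructor <;> nlinarith [sq_nonneg x]

theorem norm_exp_xiMap_sub_pow_sq_le {x r : ℝ} {n : ℕ} (hx0 : 0 < x) (hx1 : x ≤ 1 / 2)
    (hr : (n : ℝ) / 2 ≤ r) (hrn : |r - n| ≤ √n) :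
    ‖Complex.exp (Complex.I * (xiMap (1 - x) - 1) * r) - ((1 - x : ℝ) ^ n : ℝ)‖ ^ 2
      ≤ Real.exp (-(n * x)) * (8 * x * (n * x) + 32 * x ^ 2 * (n * x) ^ 2) := by
  set w := Complex.I * (xiMap (1 - x) - 1) with hw
  set l := Real.log (1 - x) with hl
  have hn : (0 : ℝ) ≤ n := n.cast_nonneg
  have hwre : w.re ≤ -x := re_I_mul_xiMap_le hx0.le (by linarith)
  have hwn : ‖w‖ ≤ 2 * x := norm_I_mul_xiMap_le hx0.le (by linarith)
  have hlx : l ≤ -x := by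
    have := Real.log_le_sub_one_of_pos (by linarith : 0 < 1 - x)
    linarith
  have hpow : (((1 - x : ℝ) ^ n : ℝ) : ℂ) = Complex.exp (n * l : ℝ) := by
    rw [← Complex.ofReal_exp, hl, Real.exp_nat_mul, Real.exp_log (by linarith)]
  have ha : (w * r).re ≤ -(n * x / 2) := by
    rw [Complex.re_mul_ofReal]
    nlinarith [mul_le_mul_of_nonneg_right hwre (by linarith : 0 ≤ r)]
  have hb : ((n * l : ℝ) : ℂ).re ≤ -(n * x / 2) := by
    rw [Complex.ofReal_re]
    nlinarith [mul_le_mul_of_nonneg_left hlx hn, mul_nonneg hn hx0.le]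
  have hwl : ‖w - l‖ ≤ 4 * x ^ 2 := by
    calc ‖w - l‖ = ‖(w + x) - ((l + x : ℝ) : ℂ)‖ := by push_cast; congr 1; ring
      _ ≤ ‖w + x‖ + ‖((l + x : ℝ) : ℂ)‖ := norm_sub_le _ _
      _ ≤ 2 * x ^ 2 + 2 * x ^ 2 := by
          gcongr
          · exact norm_I_mul_xiMap_add_le hx0.le (by linarith)
          · rw [Complex.norm_real]
            exact abs_log_one_sub_add_le hx1
      _ = 4 * x ^ 2 := by ring
  have hab : ‖w * r - (n * l : ℝ)‖ ≤ 2 * x * √n + 4 * x ^ 2 * n := by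
    calc ‖w * r - (n * l : ℝ)‖ = ‖w * ((r - n : ℝ) : ℂ) + (w - l) * (n : ℂ)‖ := by
          push_cast; congr 1; ring
      _ ≤ ‖w‖ * |r - n| + ‖w - l‖ * n := by
          refine (norm_add_le _ _).trans ?_
          rw [norm_mul w, norm_mul (w - l), Complex.norm_real, Real.norm_eq_abs, Complex.norm_natCast]
      _ ≤ 2 * x * √n + 4 * x ^ 2 * n := by gcongr
  have hexp : Real.exp (-(n * x / 2)) ^ 2 = Real.exp (-(n * x)) := by
    rw [← Real.exp_nat_mul]
    congr 1
    push_cast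
    ring
  rw [hpow]
  calc ‖Complex.exp (w * r) - Complex.exp (n * l : ℝ)‖ ^ 2
      ≤ (Real.exp (-(n * x / 2)) * (2 * x * √n + 4 * x ^ 2 * n)) ^ 2 := by
        gcongr
        exact (norm_cexp_sub_cexp_le_of_re_le ha hb).trans (by gcongr)
    _ = Real.exp (-(n * x)) * (2 * x * √n + 4 * x ^ 2 * n) ^ 2 := by rw [mul_pow, hexp]
    _ ≤ Real.exp (-(n * x)) * (8 * x * (n * x) + 32 * x ^ 2 * (n * x) ^ 2) := by
        gcongr
        nlinarith [Real.sq_sqrt hn, sq_nonneg (2 * x * √n - 4 * x ^ 2 * n)]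

theorem exp_neg_mul_pow_le_factorial {t : ℝ} (ht : 0 ≤ t) (k : ℕ) :
    Real.exp (-t) * t ^ k ≤ k.factorial := by
  have h := Real.pow_div_factorial_le_exp t ht k
  rw [div_le_iff₀ (by positivity)] at h
  rw [Real.exp_neg, inv_mul_le_iff₀ (Real.exp_pos t)]
  exact h

theorem norm_exp_xiMap_sub_pow_sq_le_mul {x r : ℝ} {n : ℕ} (hx0 : 0 < x) (hx1 : x ≤ 1 / 2)
    (hr : (n : ℝ) / 2 ≤ r) (hrn : |r - n| ≤ √n) :
    ‖Complex.exp (Complex.I * (xiMap (1 - x) - 1) * r) - ((1 - x : ℝ) ^ n : ℝ)‖ ^ 2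
      ≤ 72 * x := by
  refine (norm_exp_xiMap_sub_pow_sq_le hx0 hx1 hr hrn).trans ?_
  have ht : (0 : ℝ) ≤ n * x := by positivity
  have h1 := exp_neg_mul_pow_le_factorial ht 1
  have h2 := exp_neg_mul_pow_le_factorial ht 2
  norm_num [Nat.factorial] at h1 h2
  nlinarith [mul_le_mul_of_nonneg_left h1 hx0.le, mul_le_mul_of_nonneg_left h2 (sq_nonneg x)]

theorem norm_exp_xiMap_sub_pow_sq_le_div {x r : ℝ} {n : ℕ} (hn : 0 < n) (hx0 : 0 < x)
    (hx1 : x ≤ 1 / 2) (hr : (n : ℝ) / 2 ≤ r) (hrn : |r - n| ≤ √n) :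
    ‖Complex.exp (Complex.I * (xiMap (1 - x) - 1) * r) - ((1 - x : ℝ) ^ n : ℝ)‖ ^ 2
      ≤ 112 / n := by
  refine (norm_exp_xiMap_sub_pow_sq_le hx0 hx1 hr hrn).trans ?_
  have hn' : (0 : ℝ) < n := by exact_mod_cast hn
  have ht : (0 : ℝ) ≤ n * x := by positivity
  have h2 := exp_neg_mul_pow_le_factorial ht 2
  have h3 := exp_neg_mul_pow_le_factorial ht 3
  norm_num [Nat.factorial] at h2 h3
  rw [le_div_iff₀ hn']
  nlinarith [mul_le_mul_of_nonneg_left h3 hx0.le]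

/-- **The key integral estimate in the comparison of `K_R⁰` and `H_n⁰`.**
There exists `δ₀ ∈ (0,1)` such that for every `δ ∈ (0, δ₀)`: if `(R_n)` is a sequence
of positive reals with `R_n − n = o(n^{1/2})`, then
`∫₀^δ x^{−3/2} |exp(i(ξ(1−x)−1) R_n) − (1−x)^n|² dx → 0` as `n → ∞`. -/
theorem integral_diff_exp_pow_tendsto_zero :
    ∃ δ₀ : ℝ, δ₀ ∈ Set.Ioo (0:ℝ) 1 ∧
      ∀ δ : ℝ, δ ∈ Set.Ioo (0:ℝ) δ₀ →
        ∀ R : ℕ → ℝ, (∀ n : ℕ, 0 < R n) →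
          Tendsto (fun n : ℕ => (R n - n) / Real.sqrt n) atTop (nhds 0) →
          Tendsto
            (fun n : ℕ => ∫ x in Set.Ioo (0:ℝ) δ,
              x ^ (-(3/2) : ℝ) *
                ‖Complex.exp (Complex.I * (xiMap (1 - x) - 1) * (R n)) - ((1 - x : ℝ) ^ n : ℝ)‖ ^ 2)
            atTop (nhds 0) := by
  refine ⟨1 / 2, by norm_num, fun δ hδ R _ hlim => ?_⟩
  have hR : ∀ᶠ n : ℕ in atTop, 0 < n ∧ (n : ℝ) / 2 ≤ R n ∧ |R n - n| ≤ √n := by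
    filter_upwards [eventually_ge_atTop 4, hlim.abs.eventually_le_const (by simp : |(0 : ℝ)| < 1)]
      with n hn hle
    have hn4 : (4 : ℝ) ≤ n := by exact_mod_cast hn
    have hs : 2 ≤ √(n : ℝ) := Real.le_sqrt_of_sq_le (by linarith)
    have hle' : |R n - n| ≤ √n := by
      rwa [abs_div, abs_of_nonneg (Real.sqrt_nonneg _), div_le_one (by linarith)] at hle
    refine ⟨by omega, ?_, hle'⟩
    nlinarith [(abs_le.1 hle').1, Real.sq_sqrt (by linarith : (0 : ℝ) ≤ n)]
  have hint : MeasureTheory.IntegrableOn (fun x : ℝ => 72 * x ^ (-(1 / 2) : ℝ))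
      (Set.Ioo 0 δ) := by
    refine MeasureTheory.Integrable.const_mul ?_ 72
    exact (intervalIntegral.integrableOn_Ioo_rpow_iff hδ.1).2 (by norm_num)
  refine Tendsto.mono_right (MeasureTheory.tendsto_integral_filter_of_dominated_convergence
    (f := fun _ => (0 : ℝ)) (fun x : ℝ => 72 * x ^ (-(1 / 2) : ℝ)) ?_ ?_ hint ?_) (by simp)
  · refine Eventually.of_forall fun n => Measurable.aestronglyMeasurable ?_
    unfold xiMap
    fun_prop
  · filter_upwards [hR] with n hn
    refine (MeasureTheory.ae_restrict_iff' measurableSet_Ioo).2 (Eventually.of_forall fun x hx => ?_)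
    rw [Real.norm_of_nonneg (mul_nonneg (Real.rpow_nonneg hx.1.le _) (sq_nonneg _))]
    calc _ ≤ x ^ (-(3 / 2) : ℝ) * (72 * x) := by
          refine mul_le_mul_of_nonneg_left ?_ (Real.rpow_nonneg hx.1.le _)
          exact norm_exp_xiMap_sub_pow_sq_le_mul hx.1 (hx.2.trans hδ.2).le hn.2.1 hn.2.2
      _ = 72 * x ^ (-(1 / 2) : ℝ) := by
          have : x ^ (-(1 / 2) : ℝ) = x ^ (-(3 / 2) : ℝ) * x := by
            rw [← Real.rpow_add_one hx.1.ne']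
            norm_num
          rw [this]
          ring
  · refine (MeasureTheory.ae_restrict_iff' measurableSet_Ioo).2 (Eventually.of_forall fun x hx => ?_)
    rw [← mul_zero (x ^ (-(3 / 2) : ℝ))]
    refine Tendsto.const_mul _ ?_
    refine squeeze_zero' (Eventually.of_forall fun n => sq_nonneg _) ?_
      (tendsto_const_div_atTop_nhds_zero_nat 112)
    filter_upwards [hR] with n hn
    exact norm_exp_xiMap_sub_pow_sq_le_div hn.1 hx.1 (hx.2.trans hδ.2).le hn.2.1 hn.2.2
end
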